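/- arXiv:2501.01562 — 2 statements merged into one kernel-verified Lean document; each statement's English description precedes it below -/
import Mathlib

section
/- (Hook theorem for #-superalgebras, Theorem 4.3, stated via the idempotent characterization of cocharacter multiplicities established in Proposition 3.9.) Let F be a field of characteristic zero and A a #-superalgebra over F which is a PI-algebra. Then there exist integers d₁,l₁,d₂,l₂,d₃,l₃,d₄,l₄ ≥ 0 such that: for every quadruple ⟨n⟩ = (n₁,n₂,n₃,n₄) of natural numbers, every multipartition ⟨λ⟩ = (λ(1),λ(2),λ(3),λ(4)) ⊢ ⟨n⟩ such that λ(i) ∉ H(dᵢ,lᵢ) for at least one i ∈ {1,2,3,4}, every Young multitableau T⟨λ⟩ of shape ⟨λ⟩, and every multilinear #-superpolynomial f ∈ P⟨n⟩, the element e_{T⟨λ⟩}·f lies in Id₂#(A). (This says exactly that every ⟨n⟩-th #-cocharacter of A is contained in the quadruple hook (H(d₁,l₁),H(d₂,l₂),H(d₃,l₃),H(d₄,l₄)).) -/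
open scoped Classical

noncomputable section

namespace SSA

/-- Ordered product of a list of elements of a (possibly non-unital) multiplicative
structure; `0` for the empty list. -/
def listProd {A : Type*} [Mul A] [Zero A] : List A → A
  | [] => 0
  | [a] => a
  | a :: b :: l => a * listProd (b :: l)

/-- The ordered product `a 0 * a 1 * ⋯ * a (n-1)`. -/
def finProd {A : Type*} [Mul A] [Zero A] {n : ℕ} (a : Fin n → A) : A :=
  listProd (List.ofFn a)

/-- `A` is a PI-algebra over `F`: it satisfies a nontrivial multilinear polynomial identity. -/
def IsPI (F A : Type*) [Field F] [NonUnitalRing A] [Module F A] : Prop :=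
  ∃ n : ℕ, 1 ≤ n ∧ ∃ c : Equiv.Perm (Fin n) → F, c ≠ 0 ∧
    ∀ a : Fin n → A, ∑ σ : Equiv.Perm (Fin n), c σ • finProd (fun i => a (σ i)) = 0

variable (F : Type*) [Field F]

/-- A `#`-superalgebra: an associative (not necessarily unital) `F`-algebra `A` with a
`ℤ₂`-grading `A = A₀ ⊕ A₁` and a linear map `#` which is a graded involution or a
superinvolution. -/
structure SuperAlg (A : Type*) [NonUnitalRing A] [Module F A]
    [SMulCommClass F A A] [IsScalarTower F A A] : Type _ where
  A0 : Submodule F A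
  A1 : Submodule F A
  sup_eq_top : A0 ⊔ A1 = ⊤
  inf_eq_bot : A0 ⊓ A1 = ⊥
  mul_mem00 : ∀ a ∈ A0, ∀ b ∈ A0, a * b ∈ A0
  mul_mem01 : ∀ a ∈ A0, ∀ b ∈ A1, a * b ∈ A1
  mul_mem10 : ∀ a ∈ A1, ∀ b ∈ A0, a * b ∈ A1
  mul_mem11 : ∀ a ∈ A1, ∀ b ∈ A1, a * b ∈ A0
  sharp : A →ₗ[F] A
  sharp_sharp : ∀ a, sharp (sharp a) = a
  sharp_mem0 : ∀ a ∈ A0, sharp a ∈ A0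
  sharp_mem1 : ∀ a ∈ A1, sharp a ∈ A1
  gradedInvolution_or_superInvolution :
    (∀ a b : A, sharp (a * b) = sharp b * sharp a) ∨
    ((∀ a ∈ A0, ∀ b ∈ A0, sharp (a * b) = sharp b * sharp a) ∧
     (∀ a ∈ A0, ∀ b ∈ A1, sharp (a * b) = sharp b * sharp a) ∧
     (∀ a ∈ A1, ∀ b ∈ A0, sharp (a * b) = sharp b * sharp a) ∧
     (∀ a ∈ A1, ∀ b ∈ A1, sharp (a * b) = -(sharp b * sharp a)))

variable {F}

/-- The four components `A₀⁺, A₀⁻, A₁⁺, A₁⁻` of a `#`-superalgebra (types `0,1,2,3`). -/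
def SuperAlg.comp {A : Type*} [NonUnitalRing A] [Module F A]
    [SMulCommClass F A A] [IsScalarTower F A A] (S : SuperAlg F A) (i : Fin 4) :
    Submodule F A :=
  (if i = 0 ∨ i = 1 then S.A0 else S.A1) ⊓
    LinearMap.ker (S.sharp - (if i = 0 ∨ i = 2 then (1 : F) else (-1 : F)) • LinearMap.id)

/-- A partition of `k`, given by its (non-increasing) sequence of row lengths. -/
structure NPartition (k : ℕ) where
  part : ℕ → ℕ
  antitone : Antitone part
  part_eq_zero : ∀ i, k ≤ i → part i = 0
  sum_eq : ∑ i ∈ Finset.range k, part i = k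

/-- The cells of the Young diagram of a partition. -/
abbrev NPartition.Cell {k : ℕ} (μ : NPartition k) : Type :=
  {p : ℕ × ℕ // p.2 < μ.part p.1}

/-- A Young tableau of shape `μ ⊢ k`: a bijective filling of the diagram with `1,…,k`. -/
abbrev YTableau {k : ℕ} (μ : NPartition k) : Type :=
  Fin k ≃ μ.Cell

/-- The row stabilizer of a tableau. -/
def rowStab {k : ℕ} {μ : NPartition k} (T : YTableau μ) : Set (Equiv.Perm (Fin k)) :=
  {π | ∀ a, (T (π a)).1.1 = (T a).1.1}

/-- The column stabilizer of a tableau. -/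
def colStab {k : ℕ} {μ : NPartition k} (T : YTableau μ) : Set (Equiv.Perm (Fin k)) :=
  {π | ∀ a, (T (π a)).1.2 = (T a).1.2}

/-- A standard Young tableau: entries increase along rows and down columns. -/
def YTableau.Standard {k : ℕ} {μ : NPartition k} (T : YTableau μ) : Prop :=
  ∀ c c' : μ.Cell,
    ((c.1.1 = c'.1.1 ∧ c.1.2 < c'.1.2) ∨ (c.1.2 = c'.1.2 ∧ c.1.1 < c'.1.1)) →
      T.symm c < T.symm c'

/-- The partition `μ` lies in the infinite hook `H(d,l)`, i.e. `μ_{d+1} ≤ l`. -/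
def InHook (d l : ℕ) {k : ℕ} (μ : NPartition k) : Prop :=
  μ.part d ≤ l

variable (F)

/-- The Young symmetrizer `e_T = ∑_{σ ∈ R_T, τ ∈ C_T} sgn(τ)·στ`. -/
def youngSym {k : ℕ} {μ : NPartition k} (T : YTableau μ) :
    MonoidAlgebra F (Equiv.Perm (Fin k)) :=
  ∑ σ ∈ Finset.univ.filter (· ∈ rowStab T),
    ∑ τ ∈ Finset.univ.filter (· ∈ colStab T),
      (Equiv.Perm.sign τ : ℤ) • MonoidAlgebra.single (σ * τ) (1 : F)

/-- The function `σ ↦ trace of left multiplication by `σ` on the left ideal generated by `e`;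
for `e` a Young symmetrizer of shape `λ` this is the irreducible character `χ_λ`. -/
def idealChar {k : ℕ} (e : MonoidAlgebra F (Equiv.Perm (Fin k)))
    (σ : Equiv.Perm (Fin k)) : F :=
  LinearMap.trace F _
    ((LinearMap.mulLeft F (MonoidAlgebra.single σ (1 : F))).restrict
      (p := (Submodule.span (MonoidAlgebra F (Equiv.Perm (Fin k))) {e}).restrictScalars F)
      (q := (Submodule.span (MonoidAlgebra F (Equiv.Perm (Fin k))) {e}).restrictScalars F)
      (fun x hx => by
        simp only [Submodule.restrictScalars_mem] at hx ⊢
        simpa [smul_eq_mul] using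
          (Submodule.span (MonoidAlgebra F (Equiv.Perm (Fin k))) {e}).smul_mem
            (MonoidAlgebra.single σ (1 : F)) hx))

/-- The set of variables for a multidegree `⟨n⟩ = (n₁,n₂,n₃,n₄)`: the disjoint union of
`Fin n₁, …, Fin n₄`, a type-`i` variable being evaluated in the `i`-th component. -/
abbrev MVar (n : Fin 4 → ℕ) : Type :=
  Σ i : Fin 4, Fin (n i)

/-- The group `S⟨n⟩ = S_{n₁} × S_{n₂} × S_{n₃} × S_{n₄}`. -/
abbrev MGroup (n : Fin 4 → ℕ) : Type :=
  ∀ i : Fin 4, Equiv.Perm (Fin (n i))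

/-- The space `P⟨n⟩` of multilinear `#`-superpolynomials: a function `c` represents
`∑_{ord} c(ord) x_{ord(1)} ⋯ x_{ord(n)}`. -/
abbrev MPoly (F : Type*) (n : Fin 4 → ℕ) : Type _ :=
  (Fin (∑ i, n i) ≃ MVar n) → F

variable {F} in
/-- The (left) action of `S⟨n⟩` on `P⟨n⟩` by relabeling the type-`i` variable indices. -/
def permMPoly {n : Fin 4 → ℕ} (g : MGroup n) (c : MPoly F n) : MPoly F n :=
  fun ord => c (ord.trans (Equiv.sigmaCongrRight fun i => ((g i)⁻¹ : Equiv.Perm (Fin (n i)))))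

variable {F} in
/-- `c ∈ P⟨n⟩` is a `#`-superidentity of `A`: every admissible evaluation
(type-`i` variables in the `i`-th component) vanishes. -/
def MIsIdentity {A : Type*} [NonUnitalRing A] [Module F A]
    [SMulCommClass F A A] [IsScalarTower F A A] (S : SuperAlg F A)
    {n : Fin 4 → ℕ} (c : MPoly F n) : Prop :=
  ∀ a : MVar n → A, (∀ v : MVar n, a v ∈ S.comp v.1) →
    ∑ ord : Fin (∑ i, n i) ≃ MVar n, c ord • finProd (fun j => a (ord j)) = 0

/-- The Young symmetrizer `e_{T⟨μ⟩}` of a Young multitableau, as an element of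
`FS⟨n⟩ = MonoidAlgebra F S⟨n⟩`. -/
def multiYoungSym {n : Fin 4 → ℕ} {μ : ∀ i : Fin 4, NPartition (n i)}
    (T : ∀ i : Fin 4, YTableau (μ i)) : MonoidAlgebra F (MGroup n) :=
  ∑ σ ∈ Finset.univ.filter (fun σ : MGroup n => ∀ i, σ i ∈ rowStab (T i)),
    ∑ τ ∈ Finset.univ.filter (fun τ : MGroup n => ∀ i, τ i ∈ colStab (T i)),
      (∏ i, (Equiv.Perm.sign (τ i) : ℤ)) • MonoidAlgebra.single (σ * τ) (1 : F)

/-- The element `e_{T⟨μ⟩} · f`, for `f ∈ P⟨n⟩`. -/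
def symAct {n : Fin 4 → ℕ} {μ : ∀ i : Fin 4, NPartition (n i)}
    (T : ∀ i : Fin 4, YTableau (μ i)) (c : MPoly F n) : MPoly F n :=
  ∑ σ ∈ Finset.univ.filter (fun σ : MGroup n => ∀ i, σ i ∈ rowStab (T i)),
    ∑ τ ∈ Finset.univ.filter (fun τ : MGroup n => ∀ i, τ i ∈ colStab (T i)),
      (∏ i, (Equiv.Perm.sign (τ i) : ℤ)) • permMPoly (σ * τ) c

theorem listProd_cons_ne {A : Type*} [Mul A] [Zero A] (a : A) {l : List A} (h : l ≠ []) :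
    listProd (a :: l) = a * listProd l := by
  cases l with
  | nil => exact absurd rfl h
  | cons b l => rfl

theorem listProd_append_ne {A : Type*} [NonUnitalRing A] {l m : List A} (hl : l ≠ [])
    (hm : m ≠ []) : listProd (l ++ m) = listProd l * listProd m := by
  induction l with
  | nil => exact absurd rfl hl
  | cons a l ih =>
    by_cases h : l = []
    · subst h
      simp only [List.cons_append, List.nil_append]
      rw [listProd_cons_ne a hm]; rfl
    · rw [List.cons_append, listProd_cons_ne a (by simp [h]), ih h, listProd_cons_ne a h, mul_assoc]

theorem listProd_flatten_ne {A : Type*} [NonUnitalRing A] (Ls : List (List A))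
    (h : ∀ L ∈ Ls, L ≠ []) : listProd Ls.flatten = listProd (Ls.map listProd) := by
  induction Ls with
  | nil => rfl
  | cons L Ls ih =>
    by_cases h' : Ls = []
    · subst h'
      simp [listProd]
    · have hL : L ≠ [] := h L (by simp)
      have hF : Ls.flatten ≠ [] := by
        obtain ⟨M, Ms, rfl⟩ := List.exists_cons_of_ne_nil h'
        have : M ≠ [] := h M (by simp)
        simp [this]
      rw [List.flatten_cons, listProd_append_ne hL hF, List.map_cons,
        listProd_cons_ne _ (by simpa using h'), ih (fun L hL => h L (by simp [hL]))]

theorem pi_prefix {F A : Type*} [Field F] [NonUnitalRing A] [Module F A]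
    [SMulCommClass F A A] {d : ℕ} (hd : 1 ≤ d)
    (c : Equiv.Perm (Fin d) → F)
    (h : ∀ a : Fin d → A, ∑ σ : Equiv.Perm (Fin d), c σ • finProd (fun i => a (σ i)) = 0)
    (p : List A) (a : Fin d → A) :
    ∑ σ : Equiv.Perm (Fin d), c σ • listProd (p ++ List.ofFn (fun i => a (σ i))) = 0 := by
  by_cases hp : p = []
  · subst hp
    simpa [finProd] using h a
  · have := congrArg (fun z => listProd p * z) (h a)
    simp only [mul_zero, Finset.mul_sum, mul_smul_comm] at this
    rw [← this]
    refine Finset.sum_congr rfl fun σ _ => ?_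
    rw [listProd_append_ne hp]
    · rfl
    · intro h0
      have := congrArg List.length h0
      simp at this
      omega

theorem sublist_decomp {α : Type*} {s w : List α} (h : s.Sublist w) :
    ∃ (p : List α) (ts : List (List α)), ts.length = s.length ∧
      w = p ++ (List.zipWith List.cons s ts).flatten := by
  induction h with
  | slnil => exact ⟨[], [], rfl, rfl⟩
  | cons a _ ih =>
    obtain ⟨p, ts, h1, h2⟩ := ih
    exact ⟨a :: p, ts, h1, by rw [h2]; rfl⟩
  | cons_cons a _ ih =>
    obtain ⟨p, ts, h1, h2⟩ := ih
    exact ⟨[], p :: ts, by simp [h1], by rw [h2]; simp⟩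

theorem flatten_lt {N d : ℕ} (h : Fin d → Fin N) (hh : StrictAnti h) (t : Fin d → List (Fin N))
    (σ : Equiv.Perm (Fin d)) (hσ : σ ≠ 1) :
    (List.ofFn (fun i => h (σ i) :: t (σ i))).flatten < (List.ofFn (fun i => h i :: t i)).flatten := by
  have hex : ∃ k, σ k ≠ k := by
    by_contra hc
    push Not at hc
    exact hσ (Equiv.ext hc)
  obtain ⟨k, hk, hmin⟩ : ∃ k, σ k ≠ k ∧ ∀ j < k, σ j = j := by
    have hne : (Finset.univ.filter fun k => σ k ≠ k).Nonempty := by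
      obtain ⟨k, hk⟩ := hex
      exact ⟨k, by simpa using hk⟩
    refine ⟨Finset.min' _ hne, ?_, ?_⟩
    · have := Finset.min'_mem _ hne
      simpa using this
    · intro j hj
      by_contra hc
      exact absurd (Finset.min'_le _ j (by simpa using hc)) (not_le.mpr hj)
  have hlt : k < σ k := by
    rcases lt_trichotomy (σ k) k with h1 | h1 | h1
    · exact absurd (σ.injective (hmin _ h1)) hk
    · exact absurd h1 hk
    · exact h1
  set l1 := List.ofFn (fun i => h (σ i) :: t (σ i)) with hl1
  set l2 := List.ofFn (fun i => h i :: t i) with hl2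
  have e1 : l1 = l1.take k ++ (h (σ k) :: t (σ k)) :: l1.drop (k + 1) := by
    conv_lhs => rw [← List.take_append_drop k l1]
    rw [List.drop_eq_getElem_cons (by simp [hl1])]
    simp [hl1]
  have e2 : l2 = l2.take k ++ (h k :: t k) :: l2.drop (k + 1) := by
    conv_lhs => rw [← List.take_append_drop k l2]
    rw [List.drop_eq_getElem_cons (by simp [hl2])]
    simp [hl2]
  have e3 : l1.take k = l2.take k := by
    apply List.ext_getElem
    · simp [hl1, hl2]
    · intro i h1 h2
      simp only [List.length_take, hl1, List.length_ofFn] at h1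
      have : σ ⟨i, by omega⟩ = ⟨i, by omega⟩ := hmin _ (by rw [Fin.lt_def]; simp; omega)
      simp [hl1, hl2, this]
  rw [e1, e2, e3, List.flatten_append, List.flatten_append]
  apply List.append_left_lt
  simp only [List.flatten_cons, List.cons_append]
  rw [List.cons_lt_cons_iff]
  exact Or.inl (hh hlt)

/-- good words -/
def goodWords (N d : ℕ) : Set (List (Fin N)) :=
  {w | w.Perm (List.finRange N) ∧ ∀ s : List (Fin N), s.Sublist w → s.Pairwise (· > ·) → s.length < d}

/-- word functions -/
def wordFun (A : Type*) [NonUnitalRing A] {N : ℕ} (w : List (Fin N)) : (Fin N → A) → A :=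
  fun a => listProd (w.map a)

theorem word_mem_span {F A : Type*} [Field F] [NonUnitalRing A] [Module F A]
    [SMulCommClass F A A] {d : ℕ} (hd : 1 ≤ d)
    (c : Equiv.Perm (Fin d) → F) (hc : c 1 ≠ 0)
    (h : ∀ a : Fin d → A, ∑ σ : Equiv.Perm (Fin d), c σ • finProd (fun i => a (σ i)) = 0)
    {N : ℕ} (w : List (Fin N)) (hw : w.Perm (List.finRange N)) :
    wordFun A w ∈ Submodule.span F (wordFun A '' goodWords N d) := by
  by_contra hcon
  let B : Finset (List (Fin N)) := (List.finRange N).permutations.toFinset.filter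
    (fun w => wordFun A w ∉ Submodule.span F (wordFun A '' goodWords N d))
  have hB : B.Nonempty := ⟨w, by simp [B, hw, hcon]⟩
  obtain ⟨v, hvB, hmin⟩ : ∃ v ∈ B, ∀ u ∈ B, ¬ u < v := by
    refine ⟨B.min' hB, B.min'_mem hB, fun u hu hlt => ?_⟩
    exact absurd (B.min'_le u hu) (not_le.mpr hlt)
  obtain ⟨hv, hvn⟩ : v.Perm (List.finRange N) ∧
    wordFun A v ∉ Submodule.span F (wordFun A '' goodWords N d) := by simpa [B] using hvB
  have hbad : v ∉ goodWords N d := fun hg => hvn (Submodule.subset_span ⟨v, hg, rfl⟩)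
  obtain ⟨s, hs1, hs2, hs3⟩ : ∃ s : List (Fin N), s.Sublist v ∧ s.Pairwise (· > ·) ∧ s.length = d := by
    simp only [goodWords, Set.mem_setOf_eq, not_and, not_forall, not_lt] at hbad
    obtain ⟨s, h1, h2, h3⟩ := hbad hv
    exact ⟨s.take d, (List.take_sublist _ _).trans h1, h2.sublist (List.take_sublist _ _), by simpa using h3⟩
  obtain ⟨p, ts, ht, hvd⟩ := sublist_decomp hs1
  subst hs3
  let hh : Fin s.length → Fin N := fun i => s[i]
  let tt : Fin s.length → List (Fin N) := fun i => ts[i]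
  have hanti : StrictAnti hh := by
    intro i j hij
    exact (List.pairwise_iff_getElem.mp hs2) i j i.2 j.2 hij
  have hz : List.zipWith List.cons s ts = List.ofFn (fun i => hh i :: tt i) := by
    apply List.ext_getElem
    · simp [ht]
    · intro i h1 h2
      simp [hh, tt]
  let ws : Equiv.Perm (Fin s.length) → List (Fin N) := fun σ =>
    p ++ (List.ofFn (fun i => hh (σ i) :: tt (σ i))).flatten
  have hws1 : ws 1 = v := by rw [hvd, hz]; rfl
  have hperm : ∀ σ, (ws σ).Perm (List.finRange N) := by
    intro σ
    refine List.Perm.trans ?_ hv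
    rw [← hws1]
    refine List.Perm.append_left _ (List.Perm.flatten ?_)
    exact Equiv.Perm.ofFn_comp_perm σ (fun i => hh i :: tt i)
  have hrel : ∑ σ, c σ • wordFun A (ws σ) = 0 := by
    funext a
    have := pi_prefix hd c h (p.map a) (fun i => listProd ((hh i :: tt i).map a))
    simp only [Finset.sum_apply, Pi.smul_apply, Pi.zero_apply]
    rw [← this]
    refine Finset.sum_congr rfl fun σ _ => ?_
    congr 1
    simp only [wordFun, ws, List.map_append]
    have hfl : listProd ((List.ofFn (fun i => hh (σ i) :: tt (σ i))).flatten.map a) = 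
       listProd (List.ofFn fun i => listProd ((hh (σ i) :: tt (σ i)).map a)) := by
      rw [List.map_flatten, listProd_flatten_ne]
      · congr 1
        simp [List.map_ofFn, Function.comp_def]
      · intro L hL
        simp only [List.map_ofFn, List.mem_ofFn] at hL
        obtain ⟨i, rfl⟩ := hL
        simp
    have hne1 : (List.ofFn (fun i => hh (σ i) :: tt (σ i))).flatten.map a ≠ [] := by
      intro h0
      have h0 := congrArg List.length h0
      simp only [List.length_map, List.length_nil, List.length_eq_zero_iff] at h0
      rw [List.flatten_eq_nil_iff] at h0
      have := h0 _ (List.mem_ofFn.mpr ⟨⟨0, hd⟩, rfl⟩)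
      simp at this
    have hne2 : (List.ofFn fun i => listProd ((hh (σ i) :: tt (σ i)).map a)) ≠ [] := by
      intro h0
      have h0 := congrArg List.length h0
      simp at h0
      simp [h0] at hd
    by_cases hp : p.map a = []
    · rw [hp, List.nil_append, List.nil_append, hfl]
    · rw [listProd_append_ne hp hne1, listProd_append_ne hp hne2, hfl]
  have hmem : ∀ σ, σ ≠ 1 → wordFun A (ws σ) ∈ Submodule.span F (wordFun A '' goodWords N s.length) := by
    intro σ hσ
    by_contra hn
    refine hmin (ws σ) (by simp [B, hperm σ, hn]) ?_
    rw [← hws1]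
    exact List.append_left_lt (flatten_lt hh hanti tt σ hσ)
  apply hvn
  rw [← Finset.add_sum_erase _ _ (Finset.mem_univ (1 : Equiv.Perm (Fin s.length)))] at hrel
  rw [hws1] at hrel
  have h1 : wordFun A v = (c 1)⁻¹ • -(∑ σ ∈ Finset.univ.erase 1, c σ • wordFun A (ws σ)) := by
    rw [← eq_neg_iff_add_eq_zero.mpr hrel, smul_smul, inv_mul_cancel₀ hc, one_smul]
  rw [h1]
  refine Submodule.smul_mem _ _ (Submodule.neg_mem _ (Submodule.sum_mem _ fun σ hσ => ?_))
  exact Submodule.smul_mem _ _ (hmem σ (Finset.ne_of_mem_erase hσ))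

theorem exists_label {α : Type*} [LinearOrder α] (w : List α) (hw : w.Nodup) :
    ∃ L : α → ℕ, (∀ v ∈ w, ∃ s : List α, (v :: s).Sublist w ∧ (v :: s).Pairwise (· > ·) ∧
      s.length = L v) ∧ w.Pairwise (fun v u => u < v → L u < L v) := by
  induction w with
  | nil => exact ⟨fun _ => 0, by simp, by simp⟩
  | cons v t ih =>
    obtain ⟨hvt, ht⟩ := List.nodup_cons.mp hw
    obtain ⟨L, h1, h2⟩ := ih ht
    let S : Finset α := t.toFinset.filter (· < v)
    let m : ℕ := S.sup (fun u => L u + 1)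
    refine ⟨Function.update L v m, ?_, ?_⟩
    · intro u hu
      by_cases huv : u = v
      · subst huv
        rw [Function.update_self]
        by_cases hS : S.Nonempty
        · obtain ⟨x, hx, hxm⟩ := Finset.exists_mem_eq_sup S hS (fun u => L u + 1)
          obtain ⟨hxt, hxu⟩ : x ∈ t ∧ x < u := by simpa [S] using hx
          obtain ⟨s, hs1, hs2, hs3⟩ := h1 x hxt
          refine ⟨x :: s, hs1.cons_cons u, ?_, by simp [m, hxm, hs3]⟩
          refine List.pairwise_cons.mpr ⟨?_, hs2⟩
          intro y hy
          rcases List.mem_cons.mp hy with rfl | hy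
          · exact hxu
          · exact ((List.pairwise_cons.mp hs2).1 y hy).trans hxu
        · refine ⟨[], by simp, by simp, ?_⟩
          rw [Finset.not_nonempty_iff_eq_empty] at hS
          simp [m, hS]
      · rw [Function.update_of_ne huv]
        obtain ⟨s, hs1, hs2, hs3⟩ := h1 u (by simpa [huv] using hu)
        exact ⟨s, hs1.cons v, hs2, hs3⟩
    · refine List.pairwise_cons.mpr ⟨?_, ?_⟩
      · intro u hu huv
        rw [Function.update_self, Function.update_of_ne huv.ne]
        have : L u + 1 ≤ m := Finset.le_sup (f := fun u => L u + 1) (by simp [S, hu, huv])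
        omega
      · refine h2.imp_of_mem ?_
        intro a b ha hb hab
        rw [Function.update_of_ne (fun h : a = v => hvt (h ▸ ha)), Function.update_of_ne (fun h : b = v => hvt (h ▸ hb))]
        exact hab

theorem eq_of_filter_eq {α β : Type*} [DecidableEq β] (L : α → β) (w w' : List α)
    (hm : w.map L = w'.map L)
    (hf : ∀ c, w.filter (fun v => L v = c) = w'.filter (fun v => L v = c)) : w = w' := by
  induction w generalizing w' with
  | nil => simpa using hm.symm
  | cons v t ih =>
    cases w' with
    | nil => simp at hm
    | cons v' t' =>
      simp only [List.map_cons, List.cons.injEq] at hm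
      have h0 := hf (L v)
      simp only [List.filter_cons, hm.1, decide_true, if_true, List.cons.injEq] at h0
      obtain ⟨rfl, -⟩ := h0
      congr 1
      refine ih t' hm.2 fun c => ?_
      have h1 := hf c
      simp only [List.filter_cons] at h1
      split_ifs at h1
      · simpa using h1
      · exact h1

theorem good_label {N d : ℕ} (w : goodWords N d) : ∃ L : Fin N → Fin d,
    w.1.Pairwise (fun v u => L u = L v → v < u) := by
  obtain ⟨w, hw1, hw2⟩ := w
  have hnd : w.Nodup := hw1.nodup_iff.mpr (List.nodup_finRange N)
  obtain ⟨L, h1, h2⟩ := exists_label w hnd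
  have hlt : ∀ v, L v < d := by
    intro v
    obtain ⟨s, hs1, hs2, hs3⟩ := h1 v (hw1.mem_iff.mpr (List.mem_finRange v))
    have := hw2 _ hs1 hs2
    simp at this
    omega
  refine ⟨fun v => ⟨L v, hlt v⟩, ?_⟩
  refine (h2.and hnd).imp ?_
  rintro a b ⟨hab, hne⟩ he
  simp only [Fin.mk.injEq] at he
  rcases lt_trichotomy a b with h | h | h
  · exact h
  · exact absurd h hne
  · have := hab h
    omega

theorem good_code_inj (N d : ℕ) : ∃ f : goodWords N d → (List.Vector (Fin d) N × (Fin N → Fin d)),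
    Function.Injective f := by
  choose L hL using (fun w : goodWords N d => good_label w)
  refine ⟨fun w => (⟨w.1.map (L w), by simp [w.2.1.length_eq]⟩, L w), ?_⟩
  intro w w' h
  have h1 : w.1.map (L w) = w'.1.map (L w') := congrArg (fun z => z.1.1) h
  have h2 : L w = L w' := congrArg (fun z => z.2) h
  have hw := hL w
  have hw' := hL w'
  rw [← h2] at h1 hw'
  apply Subtype.ext
  refine eq_of_filter_eq (L w) _ _ h1 fun c => ?_
  have key : ∀ u : List (Fin N), u.Pairwise (fun v u => L w u = L w v → v < u) →
      (u.filter (fun v => L w v = c)).Pairwise (· < ·) := by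
    intro u hu
    rw [List.pairwise_filter]
    refine hu.imp ?_
    intro a b hab ha hb
    simp only [decide_eq_true_eq] at ha hb
    exact hab (hb.trans ha.symm)
  refine List.Perm.eq_of_pairwise ?_ (key _ hw) (key _ hw') ?_
  · intro a b _ _ h1 h2
    exact absurd h1 (not_lt.mpr h2.le)
  · exact (w.2.1.trans w'.2.1.symm).filter _

theorem card_le_of_indep {F A : Type*} [Field F] [NonUnitalRing A] [Module F A]
    [SMulCommClass F A A] {d : ℕ} (hd : 1 ≤ d)
    (c : Equiv.Perm (Fin d) → F) (hc : c 1 ≠ 0)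
    (h : ∀ a : Fin d → A, ∑ σ : Equiv.Perm (Fin d), c σ • finProd (fun i => a (σ i)) = 0)
    {N : ℕ} {ι : Type*} [Fintype ι] (v : ι → ((Fin N → A) → A)) (hv : LinearIndependent F v)
    (hmem : ∀ i, v i ∈ Submodule.span F
      (wordFun A '' {w : List (Fin N) | w.Perm (List.finRange N)})) :
    Fintype.card ι ≤ d ^ N * d ^ N := by
  obtain ⟨f, hf⟩ := good_code_inj N d
  haveI : Finite (goodWords N d) := Finite.of_injective f hf
  haveI : Fintype (goodWords N d) := Fintype.ofFinite _
  haveI : Fintype (wordFun A '' goodWords N d) := Fintype.ofFinite _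
  have hsp : Submodule.span F (wordFun A '' {w : List (Fin N) | w.Perm (List.finRange N)}) ≤
      Submodule.span F (wordFun A '' goodWords N d) := by
    rw [Submodule.span_le]
    rintro _ ⟨w, hw, rfl⟩
    exact word_mem_span hd c hc h w hw
  have h1 := linearIndependent_le_span' v hv (wordFun A '' goodWords N d) (by
    rintro _ ⟨i, rfl⟩
    exact hsp (hmem i))
  have h2 : Fintype.card (wordFun A '' goodWords N d) ≤ Fintype.card (goodWords N d) :=
    Fintype.card_le_of_surjective (fun w => ⟨wordFun A w.1, w.1, w.2, rfl⟩) (by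
      rintro ⟨_, w, hw, rfl⟩
      exact ⟨⟨w, hw⟩, rfl⟩)
  have h3 := Fintype.card_le_of_injective f hf
  rw [Fintype.card_prod, card_vector] at h3
  simp only [Fintype.card_fin, Fintype.card_pi, Finset.prod_const, Finset.card_univ] at h3
  have h4 : Fintype.card ι ≤ Fintype.card (wordFun A '' goodWords N d) := by
    simpa using h1
  omega

/-- the rectangle -/
abbrev Rect (b : ℕ) : Type := Fin b × Fin (2 * b)

/-- row group of the rectangle -/
def rowG (b : ℕ) : Finset (Equiv.Perm (Rect b)) := Finset.univ.filter (fun g => ∀ q, (g q).1 = q.1)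

/-- column group of the rectangle -/
def colG (b : ℕ) : Finset (Equiv.Perm (Rect b)) := Finset.univ.filter (fun g => ∀ q, (g q).2 = q.2)

/-- the antidiagonal level -/
def level (b : ℕ) (q : Rect b) : Fin (3 * b) := ⟨q.1 + q.2, by have := q.1.2; have := q.2.2; omega⟩

theorem anti_zero {F M : Type*} [Field F] [CharZero F] [AddCommGroup M] [Module F M] {b : ℕ}
    (Ψ : Equiv.Perm (Rect b) → M) (k : Equiv.Perm (Rect b)) (p q : Rect b) (hpq : p ≠ q)
    (hcol : p.2 = q.2) (hrow : (k p).1 = (k q).1) :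
    ∑ σ ∈ rowG b, ∑ τ ∈ colG b, (Equiv.Perm.sign τ : ℤ) • Ψ (σ * k * τ) = 0 := by
  have hsC : ∀ x : Rect b, (Equiv.swap p q x).2 = x.2 := by
    intro x
    rw [Equiv.swap_apply_def]
    split_ifs with h1 h2
    · rw [h1, hcol]
    · rw [h2, hcol]
    · rfl
  have hsR : ∀ x : Rect b, (Equiv.swap (k p) (k q) x).1 = x.1 := by
    intro x
    rw [Equiv.swap_apply_def]
    split_ifs with h1 h2
    · rw [h1, hrow]
    · rw [h2, hrow]
    · rfl
  have hkey : Equiv.swap (k p) (k q) * k = k * Equiv.swap p q := by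
    ext1 x
    simp only [Equiv.Perm.mul_apply]
    exact (k.injective.map_swap p q x).symm
  have h1 : ∑ σ ∈ rowG b, ∑ τ ∈ colG b, (Equiv.Perm.sign τ : ℤ) • Ψ (σ * k * τ) =
      - ∑ σ ∈ rowG b, ∑ τ ∈ colG b, (Equiv.Perm.sign τ : ℤ) • Ψ (σ * k * τ) := by
    calc ∑ σ ∈ rowG b, ∑ τ ∈ colG b, (Equiv.Perm.sign τ : ℤ) • Ψ (σ * k * τ)
        = ∑ σ ∈ rowG b, ∑ τ ∈ colG b,
          (Equiv.Perm.sign (Equiv.swap p q * τ) : ℤ) • Ψ (σ * k * (Equiv.swap p q * τ)) := by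
          refine Finset.sum_congr rfl fun σ _ => ?_
          symm
          refine Finset.sum_equiv (Equiv.mulLeft (Equiv.swap p q)) ?_ ?_
          · intro τ
            simp [colG, hsC]
          · intro τ _
            rfl
      _ = - ∑ σ ∈ rowG b, ∑ τ ∈ colG b,
          (Equiv.Perm.sign τ : ℤ) • Ψ ((σ * Equiv.swap (k p) (k q)) * k * τ) := by
          rw [← Finset.sum_neg_distrib]
          refine Finset.sum_congr rfl fun σ _ => ?_
          rw [← Finset.sum_neg_distrib]
          refine Finset.sum_congr rfl fun τ _ => ?_
          rw [Equiv.Perm.sign_mul, Equiv.Perm.sign_swap hpq, mul_assoc σ _ k, hkey]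
          simp [mul_assoc]
      _ = _ := by
          congr 1
          refine Finset.sum_equiv (Equiv.mulRight (Equiv.swap (k p) (k q))) ?_ ?_
          · intro σ
            simp only [rowG, Finset.mem_filter, Finset.mem_univ, true_and, Equiv.coe_mulRight,
              Equiv.Perm.mul_apply]
            constructor
            · intro h x
              rw [h, hsR]
            · intro h x
              have := h (Equiv.swap (k p) (k q) x)
              rw [Equiv.swap_apply_self, hsR] at this
              exact this
          · intro σ _
            rfl
  set X := ∑ σ ∈ rowG b, ∑ τ ∈ colG b, (Equiv.Perm.sign τ : ℤ) • Ψ (σ * k * τ)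
  have h2 : (2 : F) • X = 0 := by
    rw [two_smul]
    nth_rewrite 1 [h1]
    simp
  exact (smul_eq_zero.mp h2).resolve_left two_ne_zero

theorem exists_pair {b : ℕ} (k : Equiv.Perm (Rect b)) (hk : level b ∘ k = level b) (hk1 : k ≠ 1) :
    ∃ p q : Rect b, p ≠ q ∧ p.2 = q.2 ∧ (k p).1 = (k q).1 := by
  have hlev : ∀ q : Rect b, ((k q).1 : ℕ) + (k q).2 = q.1 + q.2 := by
    intro q
    have := congrFun hk q
    simpa [level, Fin.ext_iff] using this
  have hne : (Finset.univ.filter fun q => k q ≠ q).Nonempty := by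
    by_contra hc
    apply hk1
    ext1 q
    by_contra h
    exact hc ⟨q, by simpa using h⟩
  obtain ⟨q0, hq0, hmin⟩ := Finset.exists_min_image _ (fun q : Rect b => (q.1 : ℕ) + q.2) hne
  have hq0' : k q0 ≠ q0 := by simpa using hq0
  have hfix : ∀ q : Rect b, (q.1 : ℕ) + q.2 < q0.1 + q0.2 → k q = q := by
    intro q hq
    by_contra h
    have := hmin q (by simpa using h)
    omega
  -- some cell of the level of `q0` moves up
  obtain ⟨p, hpl, hp⟩ : ∃ p : Rect b, (p.1 : ℕ) + p.2 = q0.1 + q0.2 ∧ (k p).1 < p.1 := by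
    by_contra hc
    push Not at hc
    let S : Finset (Rect b) := Finset.univ.filter (fun p => (p.1 : ℕ) + p.2 = q0.1 + q0.2)
    have hsum : ∑ p ∈ S, ((k p).1 : ℕ) = ∑ p ∈ S, (p.1 : ℕ) := by
      refine Finset.sum_equiv k ?_ (fun _ _ => rfl)
      intro p
      simp [S, hlev]
    have heq := (Finset.sum_eq_sum_iff_of_le (s := S) (f := fun p => (p.1 : ℕ))
      (g := fun p => ((k p).1 : ℕ)) (fun p hp => hc p (by simpa [S] using hp))).mp hsum.symm
    have h0 := heq q0 (by simp [S])
    have h1 := hlev q0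
    apply hq0'
    ext
    · exact h0.symm
    · omega
  refine ⟨p, ((k p).1, p.2), ?_, rfl, ?_⟩
  · intro h
    have := congrArg Prod.fst h
    have this : p.1 = (k p).1 := this
    rw [← this] at hp
    exact lt_irrefl _ hp
  · have h3 : ((k p).1 : ℕ) < p.1 := hp
    have h4 := hfix ((k p).1, p.2) (by
      show ((k p).1 : ℕ) + p.2 < _
      omega)
    exact (congrArg Prod.fst h4).symm

theorem main_word {F A : Type*} [Field F] [CharZero F] [NonUnitalRing A] [Module F A]
    [SMulCommClass F A A] {d : ℕ} (hd : 1 ≤ d)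
    (c : Equiv.Perm (Fin d) → F) (hc : c 1 ≠ 0)
    (h : ∀ a : Fin d → A, ∑ σ : Equiv.Perm (Fin d), c σ • finProd (fun i => a (σ i)) = 0)
    {N b : ℕ} (e : Rect b ↪ Fin N)
    (hcard : d ^ N * d ^ N < Fintype.card {g : Equiv.Perm (Rect b) // level b ∘ g = level b})
    (a : Fin N → A) :
    ∑ σ ∈ rowG b, ∑ τ ∈ colG b, (Equiv.Perm.sign τ : ℤ) •
      listProd ((List.finRange N).map (fun i => a (Equiv.Perm.viaEmbeddingHom e (σ * τ) i))) = 0 := by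
  let ι := Equiv.Perm.viaEmbeddingHom e
  let Φ : (Fin N → A) → Equiv.Perm (Rect b) → A := fun a g =>
    listProd ((List.finRange N).map (fun i => a (ι g i)))
  let v : {g : Equiv.Perm (Rect b) // level b ∘ g = level b} → ((Fin N → A) → A) := fun g a =>
    ∑ τ ∈ colG b, (Equiv.Perm.sign τ : ℤ) • Φ a (g.1 * τ)
  have hdep : ¬ LinearIndependent F v := by
    intro hv
    refine absurd (card_le_of_indep hd c hc h v hv ?_) (not_le.mpr hcard)
    intro g
    have : v g = ∑ τ ∈ colG b, (Equiv.Perm.sign τ : ℤ) •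
        wordFun A ((List.finRange N).map (ι (g.1 * τ))) := by
      funext a
      simp [v, Φ, wordFun, Function.comp_def]
    rw [this]
    refine Submodule.sum_mem _ fun τ _ => zsmul_mem (Submodule.subset_span ?_) _
    exact ⟨_, Equiv.Perm.map_finRange_perm _, rfl⟩
  obtain ⟨x, hx, g0, hg0⟩ := Fintype.not_linearIndependent_iff.mp hdep
  have h1 : ∑ σ ∈ rowG b, ∑ g, x g • v g (fun i => a (ι (σ * g0.1⁻¹) i)) = 0 := by
    refine Finset.sum_eq_zero fun σ _ => ?_
    have := congrFun hx (fun i => a (ι (σ * g0.1⁻¹) i))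
    simpa using this
  rw [Finset.sum_comm] at h1
  have h2 : ∀ g, ∑ σ ∈ rowG b, x g • v g (fun i => a (ι (σ * g0.1⁻¹) i)) =
      x g • ∑ σ ∈ rowG b, ∑ τ ∈ colG b, (Equiv.Perm.sign τ : ℤ) • Φ a (σ * (g0.1⁻¹ * g.1) * τ) := by
    intro g
    rw [Finset.smul_sum]
    refine Finset.sum_congr rfl fun σ _ => ?_
    congr 1
    refine Finset.sum_congr rfl fun τ _ => ?_
    congr 1
    simp only [Φ]
    congr 2
    funext i
    rw [← Equiv.Perm.mul_apply, ← map_mul]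
    simp only [mul_assoc]
  rw [Finset.sum_eq_single g0] at h1
  · rw [h2] at h1
    have := (smul_eq_zero.mp h1).resolve_left hg0
    rw [inv_mul_cancel] at this
    simp only [mul_one] at this
    exact this
  · intro g _ hg
    rw [h2]
    obtain ⟨p, q, hpq, hcol, hrow⟩ := exists_pair (g0.1⁻¹ * g.1) (by
      have e1 : level b ∘ ⇑(g0.1⁻¹) = level b := by
        funext q
        have := congrFun g0.2 (g0.1⁻¹ q)
        simp only [Function.comp_apply, ← Equiv.Perm.mul_apply, mul_inv_cancel] at this
        exact this.symm
      rw [Equiv.Perm.coe_mul, ← Function.comp_assoc, e1, g.2]) (by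
      intro h
      apply hg
      apply Subtype.ext
      exact (inv_mul_eq_one.mp h).symm)
    rw [anti_zero (F := F) (Φ a) _ p q hpq hcol hrow, smul_zero]
  · intro h
    exact absurd (Finset.mem_univ _) h

theorem card_level (b : ℕ) : (b.factorial) ^ b ≤
    Fintype.card {g : Equiv.Perm (Rect b) // level b ∘ g = level b} := by
  have h0 := DomMulAct.stabilizer_card (f := level b)
  have h1 : Fintype.card {g : Equiv.Perm (Rect b) // level b ∘ g = level b} =
    ∏ i, (Fintype.card {a // level b a = i}).factorial := by
    rw [← h0]
  rw [h1]
  let em : Fin b → Fin (3 * b) := fun s => ⟨b + s, by omega⟩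
  have hem : Function.Injective em := by
    intro s t hst
    simp only [em, Fin.mk.injEq] at hst
    ext
    omega
  calc b.factorial ^ b = ∏ s : Fin b, b.factorial := by simp
    _ ≤ ∏ s : Fin b, (Fintype.card {a // level b a = em s}).factorial := by
        refine Finset.prod_le_prod' fun s _ => Nat.factorial_le ?_
        have : Fintype.card (Fin b) ≤ Fintype.card {a // level b a = em s} := by
          refine Fintype.card_le_of_injective
            (fun i : Fin b => ⟨(i, ⟨b + s - i, by omega⟩), ?_⟩) ?_
          · simp only [level, em, Fin.mk.injEq]
            omega
          · intro i j hij
            have := congrArg (fun z => z.1.1) hij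
            exact this
        simpa using this
    _ = ∏ i ∈ Finset.univ.image em, (Fintype.card {a // level b a = i}).factorial := by
        rw [Finset.prod_image (fun x _ y _ h => hem h)]
    _ ≤ ∏ i, (Fintype.card {a // level b a = i}).factorial := by
        refine Finset.prod_le_prod_of_subset_of_one_le' (Finset.subset_univ _) ?_
        intro i _ _
        exact Nat.factorial_pos _

theorem exists_b (d : ℕ) (hd : 1 ≤ d) : ∃ b : ℕ, ∀ N ≤ 4 * b ^ 2 + 1, d ^ N * d ^ N <
    Fintype.card {g : Equiv.Perm (Rect b) // level b ∘ g = level b} := by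
  have ht := FloorSemiring.tendsto_pow_div_factorial_atTop ((d : ℝ) ^ 10)
  obtain ⟨b, hb1, hb⟩ := ((Filter.eventually_ge_atTop 1).and
    (ht.eventually (gt_mem_nhds (zero_lt_one)))).exists
  refine ⟨b, fun N hN => lt_of_lt_of_le ?_ (card_level b)⟩
  have hb' : (d ^ 10) ^ b < b.factorial := by
    rw [div_lt_one (by positivity)] at hb
    exact_mod_cast hb
  calc d ^ N * d ^ N = d ^ (2 * N) := by ring
    _ ≤ d ^ (10 * b ^ 2) := Nat.pow_le_pow_right hd (by nlinarith)
    _ = ((d ^ 10) ^ b) ^ b := by rw [← pow_mul, ← pow_mul]; ring_nf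
    _ < b.factorial ^ b := Nat.pow_lt_pow_left hb' (by omega)

theorem merge_word {Q A : Type*} [NonUnitalRing A] (w : List (Q ⊕ A)) : ∃ w' : List (Q ⊕ A),
    w'.filterMap Sum.getLeft? = w.filterMap Sum.getLeft? ∧ (w' = [] ↔ w = []) ∧
    (w'.length ≤ 2 * (w.filterMap Sum.getLeft?).length ∨
      ∃ b t, w' = Sum.inr b :: t ∧ t.length ≤ 2 * (w.filterMap Sum.getLeft?).length) ∧
    ∀ φ : Q → A, listProd (w'.map (Sum.elim φ id)) = listProd (w.map (Sum.elim φ id)) := by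
  induction w with
  | nil => exact ⟨[], rfl, Iff.rfl, Or.inl (by simp), fun _ => rfl⟩
  | cons y t ih =>
    obtain ⟨t', h1, h2, h3, h4⟩ := ih
    have hcons : ∀ (y : Q ⊕ A) (φ : Q → A), listProd ((y :: t').map (Sum.elim φ id)) =
        listProd ((y :: t).map (Sum.elim φ id)) := by
      intro y φ
      by_cases ht : t = []
      · rw [h2.mpr ht, ht]
      · have ht' : t' ≠ [] := fun h => ht (h2.mp h)
        rw [List.map_cons, List.map_cons, listProd_cons_ne _ (by simpa using ht'),
          listProd_cons_ne _ (by simpa using ht), h4]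
    cases y with
    | inl q =>
      refine ⟨Sum.inl q :: t', by simp [h1], by simp, Or.inl ?_, hcons _⟩
      rcases h3 with h3 | ⟨b, t'', rfl, h3⟩
      · simp; omega
      · simp; omega
    | inr a =>
      rcases h3 with h3 | ⟨b, t'', rfl, h3⟩
      · exact ⟨Sum.inr a :: t', h1, by simp, Or.inr ⟨a, t', rfl, h3⟩, hcons _⟩
      · refine ⟨Sum.inr (a * b) :: t'', ?_, by simp, Or.inr ⟨a * b, t'', rfl, h3⟩, ?_⟩
        · exact h1
        · intro φ
          rw [← hcons]
          simp only [List.map_cons, Sum.elim_inr, id]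
          rw [listProd_cons_ne a (by simp)]
          by_cases ht : t'' = []
          · subst ht; rfl
          · rw [listProd_cons_ne _ (by simpa using ht), listProd_cons_ne _ (by simpa using ht), mul_assoc]

theorem list_main {F A : Type*} [Field F] [CharZero F] [NonUnitalRing A] [Module F A]
    [SMulCommClass F A A] {d : ℕ} (hd : 1 ≤ d)
    (c : Equiv.Perm (Fin d) → F) (hc : c 1 ≠ 0)
    (h : ∀ a : Fin d → A, ∑ σ : Equiv.Perm (Fin d), c σ • finProd (fun i => a (σ i)) = 0)
    {b : ℕ} (hb : ∀ N ≤ 4 * b ^ 2 + 1, d ^ N * d ^ N <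
      Fintype.card {g : Equiv.Perm (Rect b) // level b ∘ g = level b})
    (w : List (Rect b ⊕ A))
    (hw : (w.filterMap Sum.getLeft?).Perm (Finset.univ : Finset (Rect b)).toList)
    (x : Rect b → A) :
    ∑ σ ∈ rowG b, ∑ τ ∈ colG b, (Equiv.Perm.sign τ : ℤ) •
      listProd (w.map (Sum.elim (fun q => x ((σ * τ) q)) id)) = 0 := by
  obtain ⟨w', h1, -, h3, h4⟩ := merge_word w
  have hlen : w'.length ≤ 4 * b ^ 2 + 1 := by
    have e1 : (w.filterMap Sum.getLeft?).length = b * (2 * b) := by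
      rw [hw.length_eq]; simp
    rw [e1] at h3
    rcases h3 with h3 | ⟨b', t'', rfl, h3⟩
    · nlinarith
    · simp only [List.length_cons]; nlinarith
  rw [← h1] at hw
  have hex : ∀ q : Rect b, ∃ i : Fin w'.length, w'.get i = Sum.inl q := by
    intro q
    have : q ∈ w'.filterMap Sum.getLeft? := hw.mem_iff.mpr (by simp)
    rw [List.mem_filterMap] at this
    obtain ⟨y, hy, hyq⟩ := this
    rw [Sum.getLeft?_eq_some_iff] at hyq
    subst hyq
    exact List.mem_iff_get.mp hy
  choose e0 he0 using hex
  have hnd : (w'.filterMap Sum.getLeft?).Nodup := hw.nodup_iff.mpr (Finset.nodup_toList _)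
  have hpw : w'.Pairwise (fun y z => ∀ q ∈ y.getLeft?, ∀ r ∈ z.getLeft?, q ≠ r) := by
    have := List.pairwise_filterMap.mp hnd
    exact this
  have huniq : ∀ i j : Fin w'.length, ∀ q, w'.get i = Sum.inl q → w'.get j = Sum.inl q → i = j := by
    intro i j q hi hj
    rw [List.pairwise_iff_get] at hpw
    rcases lt_trichotomy i j with hij | hij | hij
    · exact absurd rfl (hpw i j hij q (by rw [hi]; rfl) q (by rw [hj]; rfl))
    · exact hij
    · exact absurd rfl (hpw j i hij q (by rw [hj]; rfl) q (by rw [hi]; rfl))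
  let e : Rect b ↪ Fin w'.length := ⟨e0, by
    intro q r hqr
    have := he0 q
    rw [hqr, he0 r] at this
    exact (Sum.inl.inj this).symm⟩
  have := main_word hd c hc h e (hb _ hlen) (fun i => Sum.elim x id (w'.get i))
  rw [← this]
  refine Finset.sum_congr rfl fun σ _ => Finset.sum_congr rfl fun τ _ => ?_
  congr 1
  rw [← h4]
  congr 1
  apply List.ext_getElem
  · simp
  · intro i hi1 hi2
    have hi : i < w'.length := by simpa using hi1
    simp only [List.getElem_map, List.getElem_finRange]
    change Sum.elim _ id (w'.get ⟨i, hi⟩) =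
      Sum.elim x id (w'.get ((σ * τ).viaEmbedding e ⟨i, hi⟩))
    rcases hwi : w'.get ⟨i, hi⟩ with q | y
    · have hie : e q = ⟨i, hi⟩ := huniq _ _ q (he0 q) hwi
      have hv := Equiv.Perm.viaEmbedding_apply (σ * τ) e q
      rw [hie] at hv
      have e3 : w'.get (e ((σ * τ) q)) = Sum.inl ((σ * τ) q) := he0 _
      rw [hv, e3]
      rfl
    · have hn : (⟨i, hi⟩ : Fin w'.length) ∉ Set.range e := by
        rintro ⟨q, hq⟩
        have := he0 q
        change w'.get (e q) = _ at this
        rw [hq, hwi] at this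
        cases this
      rw [Equiv.Perm.viaEmbedding_apply_of_notMem _ _ _ hn, hwi]
      rfl

theorem rowG_inv {b : ℕ} {r : Equiv.Perm (Rect b)} (h : r ∈ rowG b) : r⁻¹ ∈ rowG b := by
  simp only [rowG, Finset.mem_filter, Finset.mem_univ, true_and] at h ⊢
  intro q
  have := h (r⁻¹ q)
  rw [← Equiv.Perm.mul_apply, mul_inv_cancel] at this
  exact this.symm

theorem colG_inv {b : ℕ} {r : Equiv.Perm (Rect b)} (h : r ∈ colG b) : r⁻¹ ∈ colG b := by
  simp only [colG, Finset.mem_filter, Finset.mem_univ, true_and] at h ⊢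
  intro q
  have := h (r⁻¹ q)
  rw [← Equiv.Perm.mul_apply, mul_inv_cancel] at this
  exact this.symm

theorem sum_reduce (F : Type*) {M G : Type*} [Field F] [CharZero F] [AddCommGroup M] [Module F M]
    [Group G] {b : ℕ} (ι : Equiv.Perm (Rect b) →* G) (R C : Finset G)
    (hR : ∀ r ∈ rowG b, ∀ g ∈ R, g * ι r ∈ R) (hC : ∀ r ∈ colG b, ∀ g ∈ C, ι r * g ∈ C)
    (s : G → ℤ) (hs : ∀ r g, s (ι r * g) = Equiv.Perm.sign r * s g) (Ψ : G → M)
    (h : ∀ g k, ∑ σ ∈ rowG b, ∑ τ ∈ colG b,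
      (Equiv.Perm.sign τ : ℤ) • Ψ (g * ι (σ * τ) * k) = 0) :
    ∑ σ ∈ R, ∑ τ ∈ C, s τ • Ψ (σ * τ) = 0 := by
  have key : ∀ σ0 ∈ rowG b, ∀ τ0 ∈ colG b, ∑ σ ∈ R, ∑ τ ∈ C, s τ • Ψ (σ * τ) =
      ∑ σ ∈ R, ∑ τ ∈ C, s τ • (Equiv.Perm.sign τ0 : ℤ) • Ψ (σ * ι (σ0 * τ0) * τ) := by
    intro σ0 h1 τ0 h2
    symm
    refine Finset.sum_equiv (Equiv.mulRight (ι σ0)) ?_ ?_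
    · intro g
      refine ⟨hR _ h1 g, fun hg => ?_⟩
      have := hR _ (rowG_inv h1) _ hg
      simpa using this
    · intro g _
      refine Finset.sum_equiv (Equiv.mulLeft (ι τ0)) ?_ ?_
      · intro k
        refine ⟨hC _ h2 k, fun hk => ?_⟩
        have := hC _ (colG_inv h2) _ hk
        simpa using this
      · intro k _
        simp only [Equiv.coe_mulLeft, Equiv.coe_mulRight, hs, smul_smul, map_mul, mul_assoc]
        rw [mul_comm]
  set X := ∑ σ ∈ R, ∑ τ ∈ C, s τ • Ψ (σ * τ) with hX
  have h0 : ∑ σ0 ∈ rowG b, ∑ τ0 ∈ colG b, X = 0 := by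
    rw [Finset.sum_congr rfl fun σ0 h1 => Finset.sum_congr rfl fun τ0 h2 => key σ0 h1 τ0 h2]
    have e1 : ∀ σ0 ∈ rowG b, ∑ τ0 ∈ colG b, ∑ σ ∈ R, ∑ τ ∈ C,
        s τ • (Equiv.Perm.sign τ0 : ℤ) • Ψ (σ * ι (σ0 * τ0) * τ) =
        ∑ σ ∈ R, ∑ τ ∈ C, ∑ τ0 ∈ colG b,
        s τ • (Equiv.Perm.sign τ0 : ℤ) • Ψ (σ * ι (σ0 * τ0) * τ) := by
      intro σ0 _
      rw [Finset.sum_comm]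
      refine Finset.sum_congr rfl fun σ _ => ?_
      rw [Finset.sum_comm]
    rw [Finset.sum_congr rfl e1, Finset.sum_comm]
    refine Finset.sum_eq_zero fun σ _ => ?_
    rw [Finset.sum_comm]
    refine Finset.sum_eq_zero fun τ _ => ?_
    simp only [← Finset.smul_sum]
    rw [h σ τ, smul_zero]
  simp only [Finset.sum_const, smul_smul] at h0
  rw [← Nat.cast_smul_eq_nsmul F] at h0
  refine (smul_eq_zero.mp h0).resolve_left ?_
  have n1 : (rowG b).card ≠ 0 := Finset.card_ne_zero_of_mem (a := 1) (by simp [rowG])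
  have n2 : (colG b).card ≠ 0 := Finset.card_ne_zero_of_mem (a := 1) (by simp [colG])
  exact_mod_cast mul_ne_zero n1 n2

/-- relabelling of variables -/
def actV {n : Fin 4 → ℕ} (g : MGroup n) (v : MVar n) : MVar n := ⟨v.1, g v.1 v.2⟩

theorem actV_mul {n : Fin 4 → ℕ} (g k : MGroup n) (v : MVar n) :
    actV (g * k) v = actV g (actV k v) := rfl

theorem pi_normal {F A : Type*} [Field F] [NonUnitalRing A] [Module F A] (hPI : IsPI F A) :
    ∃ d : ℕ, 1 ≤ d ∧ ∃ c : Equiv.Perm (Fin d) → F, c 1 ≠ 0 ∧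
      ∀ a : Fin d → A, ∑ σ : Equiv.Perm (Fin d), c σ • finProd (fun i => a (σ i)) = 0 := by
  obtain ⟨d, hd, c, hc, h⟩ := hPI
  obtain ⟨σ0, h0⟩ := Function.ne_iff.mp hc
  refine ⟨d, hd, fun σ => c (σ0 * σ), by simpa using h0, fun a => ?_⟩
  rw [← h (fun i => a (σ0⁻¹ i))]
  refine Finset.sum_equiv (Equiv.mulLeft σ0) (by simp) ?_
  intro σ _
  simp

theorem eval_symAct {F A : Type*} [Field F] [NonUnitalRing A] [Module F A]
    {n : Fin 4 → ℕ} {μ : ∀ i : Fin 4, NPartition (n i)}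
    (T : ∀ i : Fin 4, YTableau (μ i)) (f : MPoly F n) (a : MVar n → A) :
    ∑ ord : Fin (∑ i, n i) ≃ MVar n, (symAct F T f) ord • finProd (fun j => a (ord j)) =
    ∑ ord : Fin (∑ i, n i) ≃ MVar n, f ord •
      ∑ σ ∈ Finset.univ.filter (fun σ : MGroup n => ∀ i, σ i ∈ rowStab (T i)),
      ∑ τ ∈ Finset.univ.filter (fun τ : MGroup n => ∀ i, τ i ∈ colStab (T i)),
      (∏ i, (Equiv.Perm.sign (τ i) : ℤ)) • finProd (fun j => a (actV (σ * τ) (ord j))) := by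
  have h1 : ∀ g : MGroup n, ∑ ord : Fin (∑ i, n i) ≃ MVar n,
      (permMPoly g f) ord • finProd (fun j => a (ord j)) =
      ∑ ord : Fin (∑ i, n i) ≃ MVar n, f ord • finProd (fun j => a (actV g (ord j))) := by
    intro g
    symm
    let E : MVar n ≃ MVar n := Equiv.sigmaCongrRight fun i => (g i : Equiv.Perm (Fin (n i)))
    refine Fintype.sum_equiv (Equiv.equivCongr (Equiv.refl _) E) _ _ ?_
    intro ord
    have e1 : permMPoly g f ((Equiv.equivCongr (Equiv.refl _) E) ord) = f ord := by
      unfold permMPoly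
      congr 1
      ext1 j
      simp [E, Sigma.map]
    rw [e1]
    rfl
  simp only [symAct, Finset.sum_apply, Pi.smul_apply, Finset.sum_smul, Finset.smul_sum]
  rw [Finset.sum_comm]
  conv_rhs => rw [Finset.sum_comm]
  refine Finset.sum_congr rfl fun σ _ => ?_
  rw [Finset.sum_comm]
  conv_rhs => rw [Finset.sum_comm]
  refine Finset.sum_congr rfl fun τ _ => ?_
  simp only [smul_assoc]
  rw [← Finset.smul_sum, h1, Finset.smul_sum]
  refine Finset.sum_congr rfl fun ord _ => ?_
  rw [smul_comm]

theorem word_zero {F A : Type*} [Field F] [CharZero F] [NonUnitalRing A] [Module F A]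
    [SMulCommClass F A A] {d : ℕ} (hd : 1 ≤ d)
    (c : Equiv.Perm (Fin d) → F) (hc : c 1 ≠ 0)
    (h : ∀ a : Fin d → A, ∑ σ : Equiv.Perm (Fin d), c σ • finProd (fun i => a (σ i)) = 0)
    {b : ℕ} (hb : ∀ N ≤ 4 * b ^ 2 + 1, d ^ N * d ^ N <
      Fintype.card {g : Equiv.Perm (Rect b) // level b ∘ g = level b})
    {V : Type*} {m : ℕ} (ord : Fin m ≃ V) (e : Rect b ↪ V) (a : V → A)
    (ι : Equiv.Perm (Rect b) → V → V) (hι1 : ∀ g q, ι g (e q) = e (g q))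
    (hι2 : ∀ g v, v ∉ Set.range e → ι g v = v) :
    ∑ σ ∈ rowG b, ∑ τ ∈ colG b, (Equiv.Perm.sign τ : ℤ) •
      finProd (fun j => a (ι (σ * τ) (ord j))) = 0 := by
  let letter : V → Rect b ⊕ A := fun v =>
    if hv : ∃ q, e q = v then Sum.inl hv.choose else Sum.inr (a v)
  have hl1 : ∀ q, letter (e q) = Sum.inl q := by
    intro q
    have hv : ∃ q', e q' = e q := ⟨q, rfl⟩
    have : letter (e q) = Sum.inl hv.choose := dif_pos hv
    rw [this, e.injective hv.choose_spec]
  have hl2 : ∀ v, v ∉ Set.range e → letter v = Sum.inr (a v) := by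
    intro v hv
    exact dif_neg hv
  have hl3 : ∀ v q, (letter v).getLeft? = some q → v = e q := by
    intro v q hq
    by_cases hv : v ∈ Set.range e
    · obtain ⟨r, rfl⟩ := hv
      rw [hl1] at hq
      simp only [Sum.getLeft?_inl, Option.some.injEq] at hq
      rw [hq]
    · rw [hl2 v hv] at hq
      simp at hq
  have hval : ∀ g v, a (ι g v) = Sum.elim (fun q => a (e (g q))) id (letter v) := by
    intro g v
    by_cases hv : v ∈ Set.range e
    · obtain ⟨r, rfl⟩ := hv
      rw [hl1, hι1]
      rfl
    · rw [hl2 v hv, hι2 g v hv]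
      rfl
  let w : List (Rect b ⊕ A) := (List.ofFn ord).map letter
  have hw : (w.filterMap Sum.getLeft?).Perm (Finset.univ : Finset (Rect b)).toList := by
    have hnd : (w.filterMap Sum.getLeft?).Nodup := by
      simp only [w, List.filterMap_map]
      refine List.Nodup.filterMap ?_ (List.nodup_ofFn.mpr ord.injective)
      intro v v' q hv hv'
      rw [hl3 v q hv, hl3 v' q hv']
    rw [List.perm_ext_iff_of_nodup hnd (Finset.nodup_toList _)]
    intro q
    simp only [Finset.mem_toList, Finset.mem_univ, iff_true]
    rw [List.mem_filterMap]
    refine ⟨Sum.inl q, ?_, rfl⟩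
    rw [← hl1 q]
    exact List.mem_map_of_mem (List.mem_ofFn.mpr ⟨ord.symm (e q), by simp⟩)
  rw [← list_main hd c hc h hb w hw (fun q => a (e q))]
  refine Finset.sum_congr rfl fun σ _ => Finset.sum_congr rfl fun τ _ => ?_
  congr 1
  unfold finProd
  congr 1
  simp only [w, List.map_map, List.map_ofFn]
  congr 1
  funext j
  exact hval _ _


/-- **The hook theorem for `#`-superalgebras** (Theorem 4.3, via the idempotent
characterization of cocharacter multiplicities of Proposition 3.9).

If the `#`-superalgebra `A` over a field `F` of characteristic zero is a PI-algebra, then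
there are integers `d₁,l₁,…,d₄,l₄ ≥ 0` such that for every multidegree `⟨n⟩`, every
multipartition `⟨λ⟩ ⊢ ⟨n⟩` with `λ(i) ∉ H(dᵢ,lᵢ)` for at least one `i`, every Young
multitableau `T⟨λ⟩` of shape `⟨λ⟩` and every `f ∈ P⟨n⟩`, the element `e_{T⟨λ⟩}·f` is a
`#`-superidentity of `A`; i.e. every `⟨n⟩`-th `#`-cocharacter of `A` lies in the quadruple
hook `(H(d₁,l₁),H(d₂,l₂),H(d₃,l₃),H(d₄,l₄))`. -/
theorem hook_theorem_for_sharp_superalgebras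
    (F A : Type*) [Field F] [CharZero F] [NonUnitalRing A] [Module F A]
    [SMulCommClass F A A] [IsScalarTower F A A] (S : SuperAlg F A) (hPI : IsPI F A) :
    ∃ d l : Fin 4 → ℕ,
      ∀ (n : Fin 4 → ℕ) (μ : ∀ i : Fin 4, NPartition (n i)),
        (∃ i : Fin 4, ¬ InHook (d i) (l i) (μ i)) →
        ∀ (T : ∀ i : Fin 4, YTableau (μ i)) (f : MPoly F n),
          MIsIdentity S (symAct F T f) := by
  obtain ⟨d, hd, c, hc, h⟩ := pi_normal hPI
  obtain ⟨b, hb⟩ := exists_b d hd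
  refine ⟨fun _ => b, fun _ => 2 * b, ?_⟩
  rintro n μ ⟨i, hi⟩ T f a -
  simp only [InHook, not_le] at hi
  rw [eval_symAct]
  refine Finset.sum_eq_zero fun ord _ => ?_
  let e0 : Rect b ↪ Fin (n i) := ⟨fun q => (T i).symm ⟨(q.1, q.2), by
      have := (μ i).antitone (Nat.le_of_lt q.1.2)
      have := q.2.2
      show (q.2 : ℕ) < (μ i).part q.1
      omega⟩, by
    intro q r hqr
    have := congrArg Subtype.val ((T i).symm.injective hqr)
    simp only [Prod.mk.injEq] at this
    ext
    · exact this.1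
    · exact this.2⟩
  have hTe : ∀ q, (T i (e0 q)).1 = ((q.1 : ℕ), (q.2 : ℕ)) := by
    intro q
    exact congrArg Subtype.val ((T i).apply_symm_apply _)
  let ι : Equiv.Perm (Rect b) →* MGroup n :=
    (MonoidHom.mulSingle (fun i => Equiv.Perm (Fin (n i))) i).comp (Equiv.Perm.viaEmbeddingHom e0)
  have hιi : ∀ g, ι g i = Equiv.Perm.viaEmbedding g e0 := by
    intro g
    simp [ι, Equiv.Perm.viaEmbeddingHom_apply]
  have hιj : ∀ g j, j ≠ i → ι g j = 1 := by
    intro g j hj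
    simp [ι, hj]
  have hrow : ∀ r ∈ rowG b, ∀ j, ι r j ∈ rowStab (T j) := by
    intro r hr j
    by_cases hj : j = i
    · subst hj
      rw [hιi]
      intro x
      by_cases hx : x ∈ Set.range e0
      · obtain ⟨q, rfl⟩ := hx
        have : (r q).1 = q.1 := by
          simp only [rowG, Finset.mem_filter] at hr
          exact hr.2 q
        rw [Equiv.Perm.viaEmbedding_apply, hTe, hTe, this]
      · rw [Equiv.Perm.viaEmbedding_apply_of_notMem _ _ _ hx]
    · rw [hιj r j hj]
      intro x
      rfl
  have hcol : ∀ r ∈ colG b, ∀ j, ι r j ∈ colStab (T j) := by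
    intro r hr j
    by_cases hj : j = i
    · subst hj
      rw [hιi]
      intro x
      by_cases hx : x ∈ Set.range e0
      · obtain ⟨q, rfl⟩ := hx
        have : (r q).2 = q.2 := by
          simp only [colG, Finset.mem_filter] at hr
          exact hr.2 q
        rw [Equiv.Perm.viaEmbedding_apply, hTe, hTe, this]
      · rw [Equiv.Perm.viaEmbedding_apply_of_notMem _ _ _ hx]
    · rw [hιj r j hj]
      intro x
      rfl
  have hzero := sum_reduce F ι
    (Finset.univ.filter (fun σ : MGroup n => ∀ i, σ i ∈ rowStab (T i)))
    (Finset.univ.filter (fun τ : MGroup n => ∀ i, τ i ∈ colStab (T i)))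
    (by
      intro r hr g hg
      simp only [Finset.mem_filter, Finset.mem_univ, true_and] at hg ⊢
      intro j x
      rw [Pi.mul_apply, Equiv.Perm.mul_apply, hg j, hrow r hr j])
    (by
      intro r hr g hg
      simp only [Finset.mem_filter, Finset.mem_univ, true_and] at hg ⊢
      intro j x
      rw [Pi.mul_apply, Equiv.Perm.mul_apply, hcol r hr j, hg j])
    (fun τ => ∏ i, (Equiv.Perm.sign (τ i) : ℤ))
    (by
      intro r g
      simp only [Pi.mul_apply, Equiv.Perm.sign_mul, Units.val_mul, Finset.prod_mul_distrib]
      congr 1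
      rw [Finset.prod_eq_single i]
      · rw [hιi]
        congr 1
        unfold Equiv.Perm.viaEmbedding
        convert Equiv.Perm.sign_extendDomain r _
      · intro j _ hj
        rw [hιj r j hj]
        simp
      · intro h
        exact absurd (Finset.mem_univ _) h)
    (fun g => finProd (fun j => a (actV g (ord j))))
    (by
      intro g k
      let E : MVar n ≃ MVar n := Equiv.sigmaCongrRight fun i => (k i : Equiv.Perm (Fin (n i)))
      let e : Rect b ↪ MVar n := ⟨fun q => ⟨i, e0 q⟩, by
        intro q r hqr
        simp only [Sigma.mk.injEq, heq_eq_eq, true_and] at hqr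
        exact e0.injective hqr⟩
      have := word_zero hd c hc h hb (ord.trans E) e (fun v => a (actV g v))
        (fun g0 v => actV (ι g0) v)
        (by
          intro g0 q
          show (⟨i, ι g0 i (e0 q)⟩ : MVar n) = ⟨i, e0 (g0 q)⟩
          rw [hιi, Equiv.Perm.viaEmbedding_apply])
        (by
          rintro g0 ⟨j, x⟩ hx
          show (⟨j, ι g0 j x⟩ : MVar n) = ⟨j, x⟩
          by_cases hj : j = i
          · subst hj
            rw [hιi, Equiv.Perm.viaEmbedding_apply_of_notMem]
            rintro ⟨q, rfl⟩
            exact hx ⟨q, rfl⟩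
          · rw [hιj g0 j hj]
            rfl)
      rw [← this]
      rfl)
  rw [hzero, smul_zero]

end SSA
end
end

section
/- (Amitsur's theorem for #-superalgebras, Corollary 5.2.) Let F be a field of characteristic zero and A a #-superalgebra over F which is a PI-algebra. Then there exist integers k₁,k₂,k₃,k₄ ≥ 1 and m₁,m₂,m₃,m₄ ≥ 1 such that: for all a₁,…,a_{k₁} ∈ A₀⁺, (St_{k₁}(a₁,…,a_{k₁}))^{m₁} = 0; for all a₁,…,a_{k₂} ∈ A₀⁻, (St_{k₂}(a₁,…,a_{k₂}))^{m₂} = 0; for all a₁,…,a_{k₃} ∈ A₁⁺, (St_{k₃}(a₁,…,a_{k₃}))^{m₃} = 0; and for all a₁,…,a_{k₄} ∈ A₁⁻, (St_{k₄}(a₁,…,a_{k₄}))^{m₄} = 0. -/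
open scoped Classical

noncomputable section

namespace SSA

variable (F : Type*) [Field F]

variable {F}

variable (F)

variable {F} in
/-- `powSucc a m = a^(m+1)` (powers in a possibly non-unital ring). -/
def powSucc {A : Type*} [Mul A] (a : A) : ℕ → A
  | 0 => a
  | k + 1 => powSucc a k * a

/-- The value `St_k(a₁,…,a_k) = ∑_{σ ∈ S_k} sgn(σ) a_{σ(1)} ⋯ a_{σ(k)}` of the standard
polynomial of degree `k`. -/
def stdPolyVal {A : Type*} [NonUnitalRing A] {k : ℕ} (a : Fin k → A) : A :=
  ∑ σ : Equiv.Perm (Fin k), (Equiv.Perm.sign σ : ℤ) • finProd (fun i => a (σ i))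

theorem aux_span {F M N : Type*} [Field F] [AddCommGroup M] [Module F M] [AddCommGroup N]
    [Module F N] {n : ℕ} (f : MultilinearMap F (fun _ : Fin n => M) N) (G : Set M)
    (h : ∀ a : Fin n → M, (∀ i, a i ∈ G) → f a = 0) :
    ∀ a : Fin n → M, (∀ i, a i ∈ Submodule.span F G) → f a = 0 := by
  have key : ∀ s : Finset (Fin n), ∀ a : Fin n → M, (∀ i ∈ s, a i ∈ Submodule.span F G) →
      (∀ i ∉ s, a i ∈ G) → f a = 0 := by
    intro s
    induction s using Finset.induction_on with
    | empty => intro a _ h2; exact h a (fun i => h2 i (by simp))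
    | insert j s hj ih =>
      intro a h1 h2
      have h3 : ∀ x ∈ Submodule.span F G, f (Function.update a j x) = 0 := by
        intro x hx
        induction hx using Submodule.span_induction with
        | mem x hx =>
          apply ih
          · intro i hi
            have : i ≠ j := fun e => hj (e ▸ hi)
            rw [Function.update_of_ne this]
            exact h1 i (Finset.mem_insert_of_mem hi)
          · intro i hi
            by_cases e : i = j
            · subst e; simpa using hx
            · rw [Function.update_of_ne e]
              exact h2 i (by simp [e, hi])
        | zero => exact f.map_update_zero a j
        | add x y _ _ hx hy => rw [f.map_update_add, hx, hy, add_zero]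
        | smul c x _ hx => rw [f.map_update_smul, hx, smul_zero]
      have := h3 (a j) (h1 j (by simp))
      simpa using this
  intro a ha
  exact key Finset.univ a (fun i _ => ha i) (fun i hi => absurd (Finset.mem_univ i) hi)

/-- multilinear evaluation -/
def evM {F : Type*} (S : Type*) [Field F] [Ring S] [Algebra F S] {n : ℕ}
    (c : Equiv.Perm (Fin n) → F) : MultilinearMap F (fun _ : Fin n => S) S :=
  ∑ σ, c σ • (MultilinearMap.mkPiAlgebraFin F n S).domDomCongr σ

theorem evM_apply {F : Type*} (S : Type*) [Field F] [Ring S] [Algebra F S] {n : ℕ}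
    (c : Equiv.Perm (Fin n) → F) (a : Fin n → S) :
    evM S c a = ∑ σ, c σ • (List.ofFn fun i => a (σ i)).prod := by
  simp [evM]

theorem chain_lemma {S V : Type*} [Ring S] [AddCommGroup V] [Module S V] (n : ℕ)
    (e : ℕ → S) (v : ℕ → V)
    (h : ∀ i < n, ∀ j ≤ n, e i • v j = if j = i + 1 then v i else 0) (m : ℕ) (hm : m ≤ n)
    (l : List ℕ) (hl : ∀ x ∈ l, x < n) :
    (l.map e).prod • v m =
      if l.length ≤ m ∧ l = List.range' (m - l.length) l.length then v (m - l.length) else 0 := by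
  induction l with
  | nil => simp
  | cons x l ih =>
    have ih' := ih (fun y hy => hl y (by simp [hy]))
    have hx := hl x (by simp)
    simp only [List.map_cons, List.prod_cons, mul_smul, ih']
    by_cases h1 : l.length ≤ m ∧ l = List.range' (m - l.length) l.length
    · rw [if_pos h1, h x hx _ (by omega)]
      by_cases h2 : m - l.length = x + 1
      · have h3 : m - (l.length + 1) = x := by omega
        rw [if_pos h2, if_pos]
        · simp [h3]
        · refine ⟨by simp; omega, ?_⟩
          simp only [List.length_cons, List.range'_succ, h3]
          rw [← h2, ← h1.2]
      · rw [if_neg h2, if_neg]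
        rintro ⟨h4, h5⟩
        simp only [List.length_cons, List.range'_succ, List.cons.injEq] at h4 h5
        omega
    · rw [if_neg h1, smul_zero, if_neg]
      rintro ⟨h4, h5⟩
      apply h1
      simp only [List.length_cons, List.range'_succ, List.cons.injEq] at h4 h5
      refine ⟨by omega, ?_⟩
      have : m - (l.length + 1) + 1 = m - l.length := by omega
      rw [this] at h5
      exact h5.2

theorem kap_bound {F S V : Type*} [Field F] [Ring S] [Algebra F S] [AddCommGroup V] [Module S V]
    [IsSimpleModule S V] {n : ℕ} (c : Equiv.Perm (Fin n) → F) (hc : c ≠ 0) (I : Set S)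
    (hI : ∀ b ∈ I, ∀ s, b * s ∈ I) (hE : ∀ a : Fin n → S, (∀ i, a i ∈ I) → evM S c a = 0)
    (hb : ∀ v : V, v ≠ 0 → ∃ b ∈ I, b • v = v) (v : Fin (n + 1) → V) :
    ¬ LinearIndependent (Module.End S V) v := by
  intro hv
  obtain ⟨σ₀, hσ₀⟩ := Function.ne_iff.mp hc
  let w : ℕ → V := fun j => if h : j < n + 1 then v ⟨j, h⟩ else 0
  have hex : ∀ i : ℕ, ∃ r : S, i < n → r ∈ I ∧ ∀ j ≤ n, r • w j = if j = i + 1 then w i else 0 := by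
    intro i
    by_cases hi : i < n
    · have hwi : w i ≠ 0 := by
        simp only [w, dif_pos (show i < n + 1 by omega)]
        exact hv.ne_zero _
      obtain ⟨b, hbI, hbw⟩ := hb _ hwi
      obtain ⟨f, hf⟩ := LinearMap.exists_extend (p := Submodule.span (Module.End S V) (Set.range v))
        ((Module.Basis.span hv).constr ℕ (fun j : Fin (n+1) => if (j : ℕ) = i + 1 then w i else 0))
      obtain ⟨r, hr⟩ := jacobson_density (R := S) f (Finset.univ.image v)
      refine ⟨b * r, fun _ => ⟨hI b hbI r, ?_⟩⟩
      intro j hj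
      have e1 : f (w j) = if j = i + 1 then w i else 0 := by
        have := congrArg (fun g => g ((Module.Basis.span hv) ⟨j, by omega⟩)) hf
        simp only [LinearMap.comp_apply, Module.Basis.constr_basis] at this
        rw [← this]
        simp [w, Module.Basis.span_apply, hj]
      have e2 : f (w j) = r • w j := by
        apply hr
        simp [w, hj]
      rw [mul_smul, ← e2, e1]
      split_ifs <;> simp [hbw]
    · exact ⟨0, fun h => absurd h hi⟩
  choose e he using hex
  have h0 := hE (fun i => e ((σ₀⁻¹ i : Fin n) : ℕ)) (fun i => (he _ (Fin.is_lt _)).1)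
  rw [evM_apply] at h0
  have h1 := congrArg (fun s => s • w n) h0
  simp only [Finset.sum_smul, zero_smul] at h1
  have key : ∀ σ : Equiv.Perm (Fin n),
      (c σ • (List.ofFn fun i => e ((σ₀⁻¹ (σ i) : Fin n) : ℕ)).prod) • w n =
        if σ = σ₀ then (algebraMap F S (c σ₀)) • w 0 else 0 := by
    intro σ
    have e1 : (List.ofFn fun i => e ((σ₀⁻¹ (σ i) : Fin n) : ℕ)) =
      (List.ofFn fun i => ((σ₀⁻¹ (σ i) : Fin n) : ℕ)).map e := by
      rw [List.map_ofFn]; rfl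
    rw [Algebra.smul_def, mul_smul, e1, chain_lemma n e w (fun i hi => (he i hi).2) n le_rfl]
    · simp only [List.length_ofFn, Nat.sub_self, le_refl, true_and]
      by_cases h : σ = σ₀
      · rw [if_pos h, if_pos, h]
        subst h
        apply List.ext_getElem <;> simp
      · rw [if_neg h, if_neg, smul_zero]
        intro h2
        apply h
        ext i
        have h3 : ((σ₀⁻¹ (σ i) : Fin n) : ℕ) = i := by
          have := congrArg (fun l => l[(i : ℕ)]?) h2
          simpa using this
        have h4 : σ₀⁻¹ (σ i) = i := Fin.ext h3
        rw [Equiv.Perm.inv_eq_iff_eq] at h4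
        rw [h4]
    · intro x hx
      rw [List.mem_ofFn] at hx
      obtain ⟨i, rfl⟩ := hx
      exact Fin.is_lt _
  rw [Finset.sum_congr rfl (fun σ _ => key σ)] at h1
  simp only [Finset.sum_ite_eq', Finset.mem_univ, if_true] at h1
  have h2 := congrArg (fun x => algebraMap F S ((c σ₀)⁻¹) • x) h1
  simp only [← mul_smul, ← map_mul, inv_mul_cancel₀ (show c σ₀ ≠ 0 from hσ₀), map_one, one_smul, smul_zero] at h2
  have h3 : w 0 = v 0 := by simp [w]
  exact hv.ne_zero 0 (h3 ▸ h2)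

theorem st_zero {K V : Type*} [Field K] [AddCommGroup V] [Module K V] {n k : ℕ}
    (h : ∀ v : Fin (n + 1) → V, ¬ LinearIndependent K v) (hk : n * n < k)
    (a : Fin k → Module.End K V) :
    ∑ σ : Equiv.Perm (Fin k), (Equiv.Perm.sign σ : ℤ) • (List.ofFn fun i => a (σ i)).prod = 0 := by
  have hr : Module.rank K V < (n + 1 : ℕ) := by
    by_contra hcon
    rw [not_lt, le_rank_iff_exists_linearIndependent_finset] at hcon
    obtain ⟨s, hs, hli⟩ := hcon
    have e : Fin (n + 1) ≃ s := (finCongr hs.symm).trans s.equivFin.symm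
    exact h _ (hli.comp e e.injective)
  have : Module.Finite K V := by
    rw [← Module.rank_lt_aleph0_iff]
    exact hr.trans (Cardinal.natCast_lt_aleph0)
  have hf : Module.finrank K V < n + 1 := by
    rw [← Module.finrank_eq_rank] at hr
    exact_mod_cast hr
  have hnl : ¬ LinearIndependent K a := by
    intro hl
    have := hl.fintype_card_le_finrank
    rw [Module.finrank_linearMap, Fintype.card_fin] at this
    have : Module.finrank K V * Module.finrank K V ≤ n * n := Nat.mul_le_mul (by omega) (by omega)
    omega
  have h2 := AlternatingMap.map_linearDependent
    (MultilinearMap.alternatization (MultilinearMap.mkPiAlgebraFin K k (Module.End K V))) a hnl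
  rw [MultilinearMap.alternatization_apply] at h2
  rw [← h2]
  apply Finset.sum_congr rfl
  intro σ _
  simp [Units.smul_def]

theorem exists_max_comm (D : Type*) [Mul D] :
    ∃ C : Set D, ∀ x, x ∈ C ↔ ∀ y ∈ C, x * y = y * x := by
  obtain ⟨C, hC⟩ := zorn_subset {s : Set D | ∀ x ∈ s, ∀ y ∈ s, x * y = y * x} (by
    intro c hc hch
    refine ⟨⋃₀ c, ?_, fun s hs => Set.subset_sUnion_of_mem hs⟩
    rintro x ⟨s, hs, hxs⟩ y ⟨t, ht, hyt⟩
    rcases hch.total hs ht with h | h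
    · exact hc ht x (h hxs) y hyt
    · exact hc hs x hxs y (h hyt))
  refine ⟨C, fun x => ⟨fun hx y hy => hC.prop x hx y hy, fun hx => ?_⟩⟩
  have : insert x C ⊆ C := by
    apply hC.le_of_ge _ (Set.subset_insert x C)
    rintro a (rfl | ha) b (rfl | hb)
    · rfl
    · exact hx b hb
    · exact (hx a ha).symm
    · exact hC.prop a ha b hb
  exact this (Set.mem_insert x C)

theorem ofFn_mul_prod {T : Type*} [Monoid T] {n : ℕ} (p q : Fin n → T)
    (h : ∀ i j, Commute (p i) (q j)) :
    (List.ofFn fun i => p i * q i).prod = (List.ofFn p).prod * (List.ofFn q).prod := by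
  induction n with
  | zero => simp
  | succ n ih =>
    simp only [List.ofFn_succ, List.prod_cons]
    rw [ih (fun i => p i.succ) (fun i => q i.succ) (fun i j => h _ _)]
    have hc : Commute (q 0) (List.ofFn fun i : Fin n => p i.succ).prod := by
      apply Commute.list_prod_right
      intro x hx
      rw [List.mem_ofFn] at hx
      obtain ⟨i, rfl⟩ := hx
      exact (h _ _).symm
    simp only [mul_assoc]
    rw [← mul_assoc (q 0), hc.eq, mul_assoc]

theorem st_act_zero_aux {S V : Type*} [Ring S] [AddCommGroup V] [Module S V]
    [IsSimpleModule S V] (hDcomm : ∀ d e : Module.End S V, d * e = e * d) {n k : ℕ}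
    (hdim : ∀ v : Fin (n + 1) → V, ¬ LinearIndependent (Module.End S V) v) (hk : n * n < k)
    (a : Fin k → S) (v : V) :
    (∑ σ : Equiv.Perm (Fin k), (Equiv.Perm.sign σ : ℤ) • (List.ofFn fun i => a (σ i)).prod) • v
      = 0 := by
  let π : S →+* Module.End (Module.End S V) V := Module.toModuleEnd (Module.End S V) V
  let _ : Field (Module.End S V) := { Module.End.instDivisionRing with mul_comm := hDcomm }
  have h := st_zero hdim hk (fun i => π (a i))
  have e2 : (∑ σ : Equiv.Perm (Fin k), (Equiv.Perm.sign σ : ℤ) •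
      (List.ofFn fun i => π (a (σ i))).prod) = π (∑ σ : Equiv.Perm (Fin k),
      (Equiv.Perm.sign σ : ℤ) • (List.ofFn fun i => a (σ i)).prod) := by
    simp only [map_sum, map_zsmul, map_list_prod, List.map_ofFn]
    rfl
  rw [e2] at h
  exact congrArg (fun f => f v) h

theorem st_act_zero {F R V : Type*} [Field F] [Ring R] [Algebra F R] [AddCommGroup V] [Module R V]
    [Module F V] [IsScalarTower F R V]
    [IsSimpleModule R V] {n : ℕ} (c : Equiv.Perm (Fin n) → F) (hc : c ≠ 0) (I : Set R)
    (hI : ∀ b ∈ I, ∀ s, b * s ∈ I) (hE : ∀ a : Fin n → R, (∀ i, a i ∈ I) → evM R c a = 0)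
    (hb : ∀ v : V, v ≠ 0 → ∃ b ∈ I, b • v = v) {k : ℕ} (hk : n * n < k) (a : Fin k → R) (v : V) :
    (∑ σ : Equiv.Perm (Fin k), (Equiv.Perm.sign σ : ℤ) • (List.ofFn fun i => a (σ i)).prod) • v
      = 0 := by
  obtain ⟨C, hC⟩ := exists_max_comm (Module.End R V)
  let ρ : R →ₐ[F] Module.End F V := Algebra.lsmul F F V
  have hρ : ∀ r v, ρ r v = r • v := fun _ _ => rfl
  let κ : Module.End R V → Module.End F V := fun d => d.restrictScalars F
  have hκ : ∀ d v, κ d v = d v := fun _ _ => rfl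
  have hκmul : ∀ x y, κ (x * y) = κ x * κ y := fun _ _ => rfl
  have hcomm : ∀ r d, Commute (ρ r) (κ d) := by
    intro r d
    ext v
    simp [hρ, hκ]
  have h1C : (1 : Module.End R V) ∈ C := (hC 1).2 (by simp)
  have hmulC : ∀ x ∈ C, ∀ y ∈ C, x * y ∈ C := by
    intro x hx y hy
    rw [hC]
    intro z hz
    have h1 := (hC x).1 hx z hz
    have h2 := (hC y).1 hy z hz
    rw [mul_assoc, h2, ← mul_assoc, h1, mul_assoc]
  let S : Subalgebra F (Module.End F V) := Algebra.adjoin F (Set.range ρ ∪ κ '' C)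
  have hρS : ∀ r, ρ r ∈ S := fun r => Algebra.subset_adjoin (Or.inl ⟨r, rfl⟩)
  have hκS : ∀ d ∈ C, κ d ∈ S := fun d hd => Algebra.subset_adjoin (Or.inr ⟨d, hd, rfl⟩)
  let ρS : R →+* S := RingHom.codRestrict (ρ : R →+* Module.End F V) S hρS
  have hρSv : ∀ r (v : V), ρS r • v = r • v := fun _ _ => rfl
  have hnt : Nontrivial V := IsSimpleModule.nontrivial R V
  have : IsSimpleModule S V := by
    rw [isSimpleModule_iff_toSpanSingleton_surjective]
    refine ⟨hnt, fun x hx y => ?_⟩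
    obtain ⟨r, hr⟩ := IsSimpleModule.toSpanSingleton_surjective R hx y
    exact ⟨ρS r, hr⟩
  -- endomorphisms
  have hmem : ∀ d : Module.End S V, ∃ d' ∈ C, ∀ v, d' v = d v := by
    intro d
    let d' : Module.End R V :=
      { toFun := d
        map_add' := d.map_add
        map_smul' := fun r v => d.map_smul (ρS r) v }
    refine ⟨d', ?_, fun v => rfl⟩
    rw [hC]
    intro y hy
    ext v
    exact d.map_smul (⟨κ y, hκS y hy⟩ : S) v
  have hDcomm : ∀ d e : Module.End S V, d * e = e * d := by
    intro d e
    obtain ⟨d', hd, hd'⟩ := hmem d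
    obtain ⟨e', he, he'⟩ := hmem e
    ext v
    have := congrArg (fun f => f v) ((hC d').1 hd e' he)
    simpa [hd', he'] using this
  -- the ideal
  let G : Set (Module.End F V) := {x | ∃ i ∈ I, ∃ d ∈ C, x = ρ i * κ d}
  let J : Set S := {s | (s : Module.End F V) ∈ Submodule.span F G}
  have hGmul : ∀ s ∈ S, ∀ x ∈ Submodule.span F G, x * s ∈ Submodule.span F G := by
    intro s hs
    induction hs using Algebra.adjoin_induction with
    | mem s hs =>
      intro x hx
      induction hx using Submodule.span_induction with
      | mem x hx =>
        obtain ⟨i, hi, d, hd, rfl⟩ := hx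
        apply Submodule.subset_span
        rcases hs with ⟨r, rfl⟩ | ⟨e, he, rfl⟩
        · refine ⟨i * r, hI i hi r, d, hd, ?_⟩
          rw [mul_assoc, ← (hcomm r d).eq, map_mul, mul_assoc]
        · refine ⟨i, hi, d * e, hmulC d hd e he, ?_⟩
          rw [mul_assoc, hκmul]
      | zero => simp
      | add x y _ _ hx hy => rw [add_mul]; exact Submodule.add_mem _ hx hy
      | smul c x _ hx => rw [smul_mul_assoc]; exact Submodule.smul_mem _ _ hx
    | algebraMap r =>
      intro x hx
      rw [← Algebra.commutes, ← Algebra.smul_def]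
      exact Submodule.smul_mem _ _ hx
    | add s t _ _ hs ht =>
      intro x hx
      rw [mul_add]; exact Submodule.add_mem _ (hs x hx) (ht x hx)
    | mul s t _ _ hs ht =>
      intro x hx
      rw [← mul_assoc]; exact ht _ (hs _ hx)
  have hEG : ∀ a : Fin n → Module.End F V, (∀ i, a i ∈ G) → evM (Module.End F V) c a = 0 := by
    intro a ha
    choose i hi d hd had using ha
    have e1 : ∀ σ : Equiv.Perm (Fin n), (List.ofFn fun j => a (σ j)).prod =
        ρ (List.ofFn fun j => i (σ j)).prod * (List.ofFn fun j => κ (d j)).prod := by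
      intro σ
      simp only [had]
      rw [ofFn_mul_prod _ _ (fun _ _ => hcomm _ _), map_list_prod, List.map_ofFn]
      congr 1
      apply List.Perm.prod_eq'
      · exact Equiv.Perm.ofFn_comp_perm σ (fun j => κ (d j))
      · rw [List.pairwise_ofFn]
        intro x y _
        change κ _ * κ _ = κ _ * κ _
        rw [← hκmul, ← hκmul, (hC _).1 (hd _) _ (hd _)]
    rw [evM_apply]
    simp only [e1, ← smul_mul_assoc, ← map_smul, ← Finset.sum_mul, ← map_sum]
    have := hE i hi
    rw [evM_apply] at this
    rw [this, map_zero, zero_mul]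
  have hEJ : ∀ a : Fin n → S, (∀ i, a i ∈ J) → evM S c a = 0 := by
    intro a ha
    have h := aux_span (evM (Module.End F V) c) G hEG (fun i => (a i : Module.End F V)) ha
    apply Subtype.ext
    rw [evM_apply] at h ⊢
    rw [ZeroMemClass.coe_zero, ← h]
    change S.val _ = _
    rw [map_sum]
    apply Finset.sum_congr rfl
    intro σ _
    rw [map_smul, map_list_prod, List.map_ofFn]
    rfl
  have hbJ : ∀ v : V, v ≠ 0 → ∃ b ∈ J, b • v = v := by
    intro v hv
    obtain ⟨b, hbI, hbv⟩ := hb v hv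
    refine ⟨ρS b, Submodule.subset_span ⟨b, hbI, 1, h1C, ?_⟩, hbv⟩
    ext v; rfl
  have hdim := kap_bound (V := V) c hc J (fun b hb s => hGmul s s.2 b hb) hEJ hbJ
  have h := st_act_zero_aux hDcomm hdim hk (fun i => ρS (a i)) v
  have e2 : (∑ σ : Equiv.Perm (Fin k), (Equiv.Perm.sign σ : ℤ) •
      (List.ofFn fun i => ρS (a (σ i))).prod) = ρS (∑ σ : Equiv.Perm (Fin k),
      (Equiv.Perm.sign σ : ℤ) • (List.ofFn fun i => a (σ i)).prod) := by
    simp only [map_sum, map_zsmul, map_list_prod, List.map_ofFn]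
    rfl
  rw [e2] at h
  exact h

theorem exists_simple {B : Type*} [Ring B] (f : B)
    (hf : ∀ m, f ^ m ≠ 0) :
    ∃ M : Submodule (Polynomial B) (Polynomial B), IsCoatom M ∧
      1 - Polynomial.C f * Polynomial.X ∈ M := by
  let N : Submodule (Polynomial B) (Polynomial B) :=
    Submodule.span _ {1 - Polynomial.C f * Polynomial.X}
  rcases eq_top_or_exists_le_coatom N with h | ⟨M, hM, hNM⟩
  · exfalso
    have h1 : (1 : Polynomial B) ∈ N := by rw [h]; trivial
    rw [Submodule.mem_span_singleton] at h1
    obtain ⟨q, hq⟩ := h1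
    rw [smul_eq_mul, mul_sub, mul_one, ← mul_assoc] at hq
    have hco : ∀ i, q.coeff i = f ^ i := by
      intro i
      induction i with
      | zero =>
        have := congrArg (fun p => Polynomial.coeff p 0) hq
        simpa using this
      | succ i ih =>
        have := congrArg (fun p => Polynomial.coeff p (i + 1)) hq
        simp only [Polynomial.coeff_sub, Polynomial.coeff_mul_X, Polynomial.coeff_mul_C,
          Polynomial.coeff_one, ih] at this
        rw [pow_succ, ← sub_eq_zero, this]; simp
    exact hf (q.natDegree + 1) (by rw [← hco]; exact Polynomial.coeff_eq_zero_of_natDegree_lt (by omega))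
  · exact ⟨M, hM, hNM (Submodule.subset_span rfl)⟩

theorem inr_listProd {F A : Type*} [Field F] [NonUnitalRing A] [Module F A]
    [SMulCommClass F A A] [IsScalarTower F A A] (l : List A) (hl : l ≠ []) :
    (Unitization.inr (listProd l) : Unitization F A) = (l.map Unitization.inr).prod := by
  induction l with
  | nil => exact absurd rfl hl
  | cons a l ih =>
    cases l with
    | nil => simp [listProd]
    | cons b l =>
      rw [listProd, Unitization.inr_mul, ih (by simp)]
      simp

theorem inr_finProd {F A : Type*} [Field F] [NonUnitalRing A] [Module F A]
    [SMulCommClass F A A] [IsScalarTower F A A] {n : ℕ} (hn : 1 ≤ n) (a : Fin n → A) :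
    (Unitization.inr (finProd a) : Unitization F A) =
      (List.ofFn fun i => (Unitization.inr (a i) : Unitization F A)).prod := by
  rw [finProd, inr_listProd, List.map_ofFn]
  · rfl
  · intro h
    have := congrArg List.length h
    simp at this
    omega

theorem inr_powSucc {F A : Type*} [Field F] [NonUnitalRing A] [Module F A]
    [SMulCommClass F A A] [IsScalarTower F A A] (a : A) (m : ℕ) :
    (Unitization.inr (powSucc a m) : Unitization F A) = (Unitization.inr a) ^ (m + 1) := by
  induction m with
  | zero => simp [powSucc]
  | succ m ih => rw [powSucc, Unitization.inr_mul, ih, ← pow_succ]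

theorem poly_ident {F B : Type*} [Field F] [Ring B] [Algebra F B] {n : ℕ}
    (c : Equiv.Perm (Fin n) → F) (P : Set B)
    (hE : ∀ b : Fin n → B, (∀ i, b i ∈ P) → evM B c b = 0)
    (p : Fin n → Polynomial B) (hp : ∀ i e, (p i).coeff e ∈ P) :
    evM (Polynomial B) c p = 0 := by
  apply aux_span _ {q : Polynomial B | ∃ b ∈ P, ∃ e : ℕ, q = Polynomial.C b * Polynomial.X ^ e}
  · intro a ha
    choose b hb e hab using ha
    have e1 : ∀ σ : Equiv.Perm (Fin n), (List.ofFn fun j => a (σ j)).prod =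
        Polynomial.C (List.ofFn fun j => b (σ j)).prod *
          (List.ofFn fun j => (Polynomial.X ^ (e j) : Polynomial B)).prod := by
      intro σ
      simp only [hab]
      rw [ofFn_mul_prod _ _ (fun _ _ => Polynomial.commute_X_pow _ _ |>.symm), map_list_prod,
        List.map_ofFn]
      congr 1
      apply List.Perm.prod_eq'
      · exact Equiv.Perm.ofFn_comp_perm σ (fun j => (Polynomial.X ^ (e j) : Polynomial B))
      · rw [List.pairwise_ofFn]
        intro x y _
        exact Commute.pow_pow (Commute.refl _) _ _
    have := hE b hb
    rw [evM_apply] at this ⊢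
    simp only [e1, ← smul_mul_assoc, ← Finset.sum_mul]
    have e2 : ∑ σ, c σ • Polynomial.C (List.ofFn fun j => b (σ j)).prod =
        Polynomial.C (∑ σ, c σ • (List.ofFn fun j => b (σ j)).prod) := by
      rw [map_sum]
      exact Finset.sum_congr rfl (fun σ _ => Polynomial.smul_C _ _)
    rw [e2, this, map_zero, zero_mul]
  · intro i
    rw [(p i).as_sum_range_C_mul_X_pow]
    exact Submodule.sum_mem _ (fun e _ => Submodule.subset_span ⟨_, hp i e, e, rfl⟩)

theorem amitsur_main (F A : Type*) [Field F] [NonUnitalRing A] [Module F A]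
    [SMulCommClass F A A] [IsScalarTower F A A] (hPI : IsPI F A) :
    ∃ k m : ℕ, ∀ a : Fin (k + 1) → A, powSucc (stdPolyVal a) m = 0 := by
  obtain ⟨n, hn, c, hc, hid⟩ := hPI
  refine ⟨n * n, ?_⟩
  let B := (Fin (n * n + 1) → A) → Unitization F A
  let f : B := fun a => Unitization.inr (stdPolyVal a)
  by_cases hnil : ∃ m, f ^ m = 0
  · obtain ⟨m, hm⟩ := hnil
    refine ⟨m, fun a => ?_⟩
    apply Unitization.inr_injective (R := F)
    rw [inr_powSucc, Unitization.inr_zero, pow_succ]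
    have : (Unitization.inr (stdPolyVal a) : Unitization F A) ^ m = 0 := congrFun hm a
    rw [this, zero_mul]
  · exfalso
    push Not at hnil
    obtain ⟨M, hM, hfM⟩ := exists_simple f hnil
    have hsimple : IsSimpleModule (Polynomial B) (Polynomial B ⧸ M) :=
      isSimpleModule_iff_isCoatom.mpr hM
    let φ : B →+* ((Fin (n * n + 1) → A) → F) :=
      RingHom.compLeft (Unitization.fstHom F A : Unitization F A →+* F) _
    have hφ : ∀ b a, φ b a = (b a).fst := fun _ _ => rfl
    let I : Set (Polynomial B) := {p | p.map φ = 0}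
    let v₀ : Polynomial B ⧸ M := Submodule.Quotient.mk 1
    have hv₀ : v₀ ≠ 0 := by
      intro h
      rw [Submodule.Quotient.mk_eq_zero] at h
      apply hM.1
      rw [Submodule.eq_top_iff']
      intro x
      simpa using M.smul_mem x h
    have hfv : (Polynomial.C f * Polynomial.X) • v₀ = v₀ := by
      symm
      rw [← Submodule.Quotient.mk_smul, Submodule.Quotient.eq]
      simpa using hfM
    have hφf : φ f = 0 := by
      funext a; rw [hφ]; simp [f]
    have hEP : ∀ b : Fin n → B, (∀ i, b i ∈ {b | φ b = 0}) → evM B c b = 0 := by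
      intro b hb
      have hb' : ∀ i a, b i a = Unitization.inr (b i a).snd := by
        intro i a
        apply Unitization.ext
        · have := congrFun (hb i) a
          rw [hφ] at this
          simpa using this
        · simp
      funext a
      have h1 := congrArg (Unitization.inr (R := F)) (hid (fun i => (b i a).snd))
      rw [evM_apply]
      rw [← Unitization.inrHom_apply F F, map_sum] at h1
      simp only [map_smul, Unitization.inrHom_apply, inr_finProd hn, ← hb', Unitization.inr_zero] at h1
      rw [Pi.zero_apply, ← h1, Finset.sum_apply]
      apply Finset.sum_congr rfl
      intro σ _
      rw [Pi.smul_apply]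
      congr 1
      have := map_list_prod (Pi.evalRingHom (fun _ => Unitization F A) a)
        (List.ofFn fun i => b (σ i))
      rw [List.map_ofFn] at this
      exact this
    have hact := st_act_zero (V := Polynomial B ⧸ M) c hc I
      (by
        intro b hb s
        change Polynomial.map φ (b * s) = 0
        rw [Polynomial.map_mul, show Polynomial.map φ b = 0 from hb, zero_mul])
      (by
        intro a ha
        apply poly_ident c {b | φ b = 0} hEP
        intro i e
        have := congrArg (fun q => Polynomial.coeff q e) (ha i)
        simpa using this)
      (by
        intro v hv
        obtain ⟨s, hs⟩ := IsSimpleModule.toSpanSingleton_surjective (Polynomial B) hv v₀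
        obtain ⟨t, ht⟩ := IsSimpleModule.toSpanSingleton_surjective (Polynomial B) hv₀ v
        rw [LinearMap.toSpanSingleton_apply] at hs ht
        refine ⟨t * (Polynomial.C f * Polynomial.X) * s, ?_, ?_⟩
        · change Polynomial.map φ _ = 0
          simp [Polynomial.map_mul, hφf]
        · rw [mul_smul, hs, mul_smul, hfv, ht])
      (k := n * n + 1) (by omega)
      (fun j => Polynomial.C (fun a => Unitization.inr (a j) : B))
      ((Polynomial.X : Polynomial B) • v₀)
    have hst : (∑ σ : Equiv.Perm (Fin (n * n + 1)), (Equiv.Perm.sign σ : ℤ) •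
        (List.ofFn fun i => Polynomial.C (fun a => Unitization.inr (a (σ i)) : B)).prod) =
        Polynomial.C f := by
      have : f = ∑ σ : Equiv.Perm (Fin (n * n + 1)), (Equiv.Perm.sign σ : ℤ) •
        (List.ofFn fun i => (fun a => Unitization.inr (a (σ i)) : B)).prod := by
        funext a
        simp only [f, stdPolyVal]
        rw [← Unitization.inrHom_apply F F, map_sum, Finset.sum_apply]
        apply Finset.sum_congr rfl
        intro σ _
        rw [map_zsmul, Pi.smul_apply, Unitization.inrHom_apply, inr_finProd (by omega)]
        congr 1
        have := map_list_prod (Pi.evalRingHom (fun _ => Unitization F A) a)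
          (List.ofFn fun i => (fun a => Unitization.inr (a (σ i)) : B))
        rw [List.map_ofFn] at this
        exact this.symm
      rw [this]
      simp only [map_sum, map_zsmul]
      apply Finset.sum_congr rfl
      intro σ _
      congr 1
      have e := map_list_prod (Polynomial.C : B →+* Polynomial B)
        (List.ofFn fun i => (fun a => Unitization.inr (a (σ i)) : B))
      rw [List.map_ofFn] at e
      exact e.symm
    rw [hst, ← mul_smul, hfv] at hact
    exact hv₀ hact

/-- **Amitsur's theorem for `#`-superalgebras** (Corollary 5.2).

If a `#`-superalgebra `A` over a field of characteristic zero is a PI-algebra, then there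
exist `k₁,…,k₄ ≥ 1` and `m₁,…,m₄ ≥ 1` (here `kᵢ = k i + 1`, `mᵢ = m i + 1`) such that for
each type `i`, the power `St_{kᵢ}^{mᵢ}` vanishes on the `i`-th component
(`A₀⁺, A₀⁻, A₁⁺, A₁⁻` for `i = 0,1,2,3`). -/
theorem amitsur_theorem_for_sharp_superalgebras
    (F A : Type*) [Field F] [CharZero F] [NonUnitalRing A] [Module F A]
    [SMulCommClass F A A] [IsScalarTower F A A] (S : SuperAlg F A) (hPI : IsPI F A) :
    ∃ k m : Fin 4 → ℕ,
      ∀ i : Fin 4, ∀ a : Fin (k i + 1) → A, (∀ j, a j ∈ S.comp i) →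
        powSucc (stdPolyVal a) (m i) = 0 := by
  obtain ⟨k, m, h⟩ := amitsur_main F A hPI
  exact ⟨fun _ => k, fun _ => m, fun _ a _ => h a⟩

end SSA
end
end
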